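/- arXiv:1307.2686 — 7 statements merged into one kernel-verified Lean document; each statement's English description precedes it below -/
import Mathlib

section
/- Let {μ(t,x)} be a Gaussian transition family on H satisfying Hypothesis 2.1, and suppose L(t)x := m(t,x) − m(t,0) defines a C0-semigroup (L(t)) on H with generator A. Let M ≥ 1 and λ₀ > 0 be such that ‖L(t)‖ ≤ M e^{λ₀ t} and ‖m(t,0)‖ ≤ M e^{λ₀ t} for all t ≥ 0, fix λ > λ₀, and set b_H := λ ∫₀^∞ e^{−λ t} m(t,0) dt (Bochner integral in H). Then for every h ∈ dom(A*), every x ∈ H and every t ≥ 0: ⟨m(t,x),h⟩ = ⟨L(t)x,h⟩ + ∫₀ᵗ ( λ⟨L(s)b_H, h⟩ − ⟨L(s)b_H, A*h⟩ ) ds. -/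
open MeasureTheory ProbabilityTheory Set Filter
open scoped InnerProductSpace NNReal

/-- A Borel probability measure on a real Hilbert space is Gaussian if every continuous
linear functional has a (possibly degenerate) Gaussian distribution under it. -/
def IsGaussianMeasure {H : Type} [NormedAddCommGroup H] [InnerProductSpace ℝ H]
    [MeasurableSpace H] (μ : Measure H) : Prop :=
  ∀ ℓ : H →L[ℝ] ℝ, ∃ (a : ℝ) (v : ℝ≥0), μ.map ℓ = gaussianReal a v

/-- An orthonormal family in a separable inner product space is countable. -/
theorem Orthonormal.countable_of_separableSpace {ι H : Type*} [NormedAddCommGroup H]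
    [InnerProductSpace ℝ H] [TopologicalSpace.SeparableSpace H] {e : ι → H}
    (he : Orthonormal ℝ e) : Countable ι := by
  refine Pairwise.countable_of_isOpen_disjoint (s := fun i => Metric.ball (e i) (1 / 2)) ?_
    (fun _ => Metric.isOpen_ball) (fun i => ⟨e i, Metric.mem_ball_self (by norm_num)⟩)
  intro i j hij
  refine Metric.ball_disjoint_ball ?_
  have hsq : ‖e i - e j‖ ^ 2 = 2 := by
    rw [norm_sub_sq_real, he.2 hij, he.1 i, he.1 j]; norm_num
  rw [dist_eq_norm]
  nlinarith [norm_nonneg (e i - e j)]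

/-- In a separable Hilbert space, weak measurability implies measurability. -/
theorem measurable_of_forall_measurable_inner {α H : Type*} [MeasurableSpace α]
    [NormedAddCommGroup H] [InnerProductSpace ℝ H] [CompleteSpace H]
    [TopologicalSpace.SeparableSpace H] [MeasurableSpace H] [BorelSpace H] {f : α → H}
    (hf : ∀ h : H, Measurable fun a => ⟪f a, h⟫_ℝ) : Measurable f := by
  obtain ⟨w, e, -⟩ := exists_hilbertBasis ℝ H
  have : Countable w := e.orthonormal.countable_of_separableSpace
  refine measurable_of_tendsto_metrizable' (atTop : Filter (Finset w))
    (f := fun s a => ∑ i ∈ s, ⟪f a, e i⟫_ℝ • e i) (fun s => ?_) ?_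
  · exact Finset.measurable_fun_sum s fun i _ => (hf (e i)).smul_const (e i)
  · refine tendsto_pi_nhds.2 fun a => ?_
    have := e.hasSum_repr (f a)
    simpa only [HasSum, e.repr_apply_apply, real_inner_comm,
      SummationFilter.unconditional_filter] using this

/-- If a mixture of Gaussian measures on `ℝ` is Gaussian, then its mean is the average of
their means. -/
theorem integral_mean_of_gaussianReal_mixture {α : Type*} [MeasurableSpace α] (ν : Measure α)
    {a : α → ℝ} {v : α → ℝ≥0} (ha : Measurable a) (hv : Measurable v) {a' : ℝ} {v' : ℝ≥0}
    (hmix : ∀ B : Set ℝ, MeasurableSet B →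
      gaussianReal a' v' B = ∫⁻ y, gaussianReal (a y) (v y) B ∂ν) :
    a' = ∫ y, a y ∂ν := by
  let κ : Kernel α ℝ := ⟨fun y => gaussianReal (a y) (v y),
    measurable_gaussianReal.comp (ha.prodMk hv)⟩
  have hbind : gaussianReal a' v' = (κ ∘ₖ Kernel.const Unit ν) () := by
    ext B hB
    rw [Kernel.comp_apply' _ _ _ hB, hmix B hB]
    rfl
  have hint : Integrable (fun r : ℝ => r) ((κ ∘ₖ Kernel.const Unit ν) ()) := by
    rw [← hbind]
    exact memLp_one_iff_integrable.1 (memLp_id_gaussianReal 1)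
  have h := Kernel.integral_comp hint
  rw [← hbind, integral_id_gaussianReal] at h
  rw [h]
  refine integral_congr_ae (ae_of_all _ fun y => ?_)
  exact integral_id_gaussianReal

/-- Laplace transform of the increments of a scalar function. -/
theorem integral_exp_mul_shift_sub {f : ℝ → ℝ} {lam : ℝ} (hlam : 0 < lam)
    (hint : IntegrableOn (fun u => Real.exp (-lam * u) * f u) (Ioi 0)) {s : ℝ} (hs : 0 ≤ s) :
    lam * ∫ r in Ioi (0:ℝ), Real.exp (-lam * r) * (f (r + s) - f s) =
      lam * (Real.exp (lam * s) * ((∫ u in Ioi (0:ℝ), Real.exp (-lam * u) * f u) -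
        ∫ u in (0:ℝ)..s, Real.exp (-lam * u) * f u)) - f s := by
  have hexp := integrableOn_exp_mul_Ioi (neg_lt_zero.2 hlam) 0
  have hpre : (fun r : ℝ => r + s) ⁻¹' Ioi s = Ioi 0 := by ext r; simp
  have hmp := measurePreserving_add_right (volume : Measure ℝ) s
  have hemb := measurableEmbedding_addRight s
  have hfun : (fun r => Real.exp (-lam * r) * f (r + s)) =
      fun r => Real.exp (lam * s) * (Real.exp (-lam * (r + s)) * f (r + s)) := by
    ext r
    rw [← mul_assoc, ← Real.exp_add]
    ring_nf
  have hshift : ∫ r in Ioi (0:ℝ), Real.exp (-lam * r) * f (r + s) =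
      Real.exp (lam * s) * ∫ u in Ioi s, Real.exp (-lam * u) * f u := by
    rw [hfun, integral_const_mul, ← hpre,
      hmp.setIntegral_preimage_emb hemb (fun u => Real.exp (-lam * u) * f u)]
  have hshift_int : IntegrableOn (fun r => Real.exp (-lam * r) * f (r + s)) (Ioi 0) := by
    rw [hfun, ← hpre]
    refine Integrable.const_mul ?_ _
    exact (hmp.integrableOn_comp_preimage hemb).2 (hint.mono_set (Ioi_subset_Ioi hs))
  have hsplit : ∫ u in Ioi s, Real.exp (-lam * u) * f u =
      (∫ u in Ioi (0:ℝ), Real.exp (-lam * u) * f u) -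
        ∫ u in (0:ℝ)..s, Real.exp (-lam * u) * f u := by
    rw [← intervalIntegral.integral_Ioi_sub_Ioi hint hs]; ring
  simp_rw [mul_sub (Real.exp _)]
  rw [integral_sub hshift_int (hexp.mul_const _), integral_mul_const,
    integral_exp_mul_Ioi (neg_lt_zero.2 hlam), hshift, hsplit]
  simp
  field_simp

/-- If `F s = e^{λs} (I - ∫₀ˢ e^{-λu} f u du)` then `F' = λF - f`. -/
theorem integral_resolvent_transform {f : ℝ → ℝ} (hf : ContinuousOn f (Ici 0)) (lam I : ℝ)
    {t : ℝ} (ht : 0 ≤ t) :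
    ∫ s in (0:ℝ)..t, (lam * (Real.exp (lam * s) *
        (I - ∫ u in (0:ℝ)..s, Real.exp (-lam * u) * f u)) - f s) =
      Real.exp (lam * t) * (I - ∫ u in (0:ℝ)..t, Real.exp (-lam * u) * f u) - I := by
  let g : ℝ → ℝ := fun u => f (max u 0)
  have hg : Continuous g := hf.comp_continuous (by fun_prop) fun u => le_max_right u 0
  have hfg : ∀ u, 0 ≤ u → f u = g u := fun u hu => by simp only [g, max_eq_left hu]
  have hFI : ∀ s, 0 ≤ s → ∫ u in (0:ℝ)..s, Real.exp (-lam * u) * f u =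
      ∫ u in (0:ℝ)..s, Real.exp (-lam * u) * g u := by
    intro s hs
    refine intervalIntegral.integral_congr fun u hu => ?_
    rw [uIcc_of_le hs] at hu
    simp only [hfg u hu.1]
  have hcont : Continuous fun u => Real.exp (-lam * u) * g u := by fun_prop
  have hd : ∀ s, HasDerivAt (fun s => Real.exp (lam * s) *
      (I - ∫ u in (0:ℝ)..s, Real.exp (-lam * u) * g u))
      (lam * (Real.exp (lam * s) *
        (I - ∫ u in (0:ℝ)..s, Real.exp (-lam * u) * g u)) - g s) s := by
    intro s
    have h1 : HasDerivAt (fun s => Real.exp (lam * s)) (Real.exp (lam * s) * lam) s := by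
      simpa using ((hasDerivAt_id s).const_mul lam).exp
    have h2 := (hcont.integral_hasStrictDerivAt 0 s).hasDerivAt
    have h3 := h1.mul (h2.const_sub I)
    convert! h3 using 1
    have : Real.exp (lam * s) * Real.exp (-lam * s) = 1 := by
      rw [← Real.exp_add]; simp
    linear_combination (g s) * this
  have hcontd : Continuous fun s => lam * (Real.exp (lam * s) *
        (I - ∫ u in (0:ℝ)..s, Real.exp (-lam * u) * g u)) - g s := by
    have : Continuous fun s => Real.exp (lam * s) *
      (I - ∫ u in (0:ℝ)..s, Real.exp (-lam * u) * g u) :=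
      continuous_iff_continuousAt.2 fun s => (hd s).continuousAt
    fun_prop
  have key := intervalIntegral.integral_eq_sub_of_hasDerivAt (fun s _ => hd s)
    (hcontd.intervalIntegrable 0 t)
  rw [hFI t ht]
  simp only [mul_zero, Real.exp_zero, intervalIntegral.integral_same, sub_zero, one_mul] at key
  rw [← key]
  refine intervalIntegral.integral_congr fun u hu => ?_
  rw [uIcc_of_le ht] at hu
  simp only [hfg u hu.1, hFI u hu.1]

/-- The one-dimensional marginals of a Gaussian measure on a separable Hilbert space, in terms
of its mean and covariance. -/
theorem IsGaussianMeasure.map_inner_eq {H : Type} [NormedAddCommGroup H] [InnerProductSpace ℝ H]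
    [CompleteSpace H] [TopologicalSpace.SeparableSpace H] [MeasurableSpace H] [BorelSpace H]
    {μ : Measure H} (hμ : IsGaussianMeasure μ) (h : H) :
    μ.map (fun y => ⟪y, h⟫_ℝ) = gaussianReal ⟪∫ y, y ∂μ, h⟫_ℝ
      (∫ y, ⟪y - ∫ z, z ∂μ, h⟫_ℝ * ⟪y - ∫ z, z ∂μ, h⟫_ℝ ∂μ).toNNReal := by
  have : IsGaussian μ := isGaussian_of_map_eq_gaussianReal hμ
  have hfun : (fun y => ⟪y, h⟫_ℝ) = innerSL ℝ h := by
    ext y; simp [real_inner_comm]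
  have hint : Integrable (fun y : H => y) μ := IsGaussian.integrable_id
  have hmean : ∫ y, innerSL ℝ h y ∂μ = ⟪∫ y, y ∂μ, h⟫_ℝ := by
    rw [(innerSL ℝ h).integral_comp_comm hint, ← hfun]
  rw [hfun, IsGaussian.map_eq_gaussianReal, variance_eq_integral (by fun_prop), hmean, ← hfun]
  simp_rw [inner_sub_left, sq]

/-- The mean of a Gaussian transition family with affine mean satisfies the cocycle identity
`m(s + t, 0) = L(t) m(s, 0) + m(t, 0)`. -/
theorem gaussian_transition_mean_cocycle
    {H : Type} [NormedAddCommGroup H] [InnerProductSpace ℝ H] [CompleteSpace H]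
    [TopologicalSpace.SeparableSpace H] [MeasurableSpace H] [BorelSpace H]
    {μ : ℝ → H → Measure H} {m : ℝ → H → H} {Q : ℝ → H → H →L[ℝ] H}
    (hprob : ∀ t ≥ (0:ℝ), ∀ x, IsProbabilityMeasure (μ t x))
    (hdirac : ∀ x, μ 0 x = Measure.dirac x)
    (hgauss : ∀ t > (0:ℝ), ∀ x, IsGaussianMeasure (μ t x))
    (hmean : ∀ t ≥ (0:ℝ), ∀ x, m t x = ∫ y, y ∂(μ t x))
    (hcov : ∀ t ≥ (0:ℝ), ∀ x, ∀ h k : H,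
      ⟪Q t x h, k⟫_ℝ = ∫ y, ⟪y - m t x, h⟫_ℝ * ⟪y - m t x, k⟫_ℝ ∂(μ t x))
    (hCK : ∀ s ≥ (0:ℝ), ∀ t ≥ (0:ℝ), ∀ x, ∀ B : Set H, MeasurableSet B →
      μ (s + t) x B = ∫⁻ y, μ t y B ∂(μ s x))
    (hyp2m : ∀ t ≥ (0:ℝ), ∀ h : H, Continuous (fun x => ⟪m t x, h⟫_ℝ))
    (hyp2Q : ∀ t ≥ (0:ℝ), ∀ h k : H, Continuous (fun x => ⟪Q t x h, k⟫_ℝ))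
    {L : ℝ → H →L[ℝ] H} (hLdef : ∀ t ≥ (0:ℝ), ∀ x, L t x = m t x - m t 0)
    (hL0 : L 0 = ContinuousLinearMap.id ℝ H)
    {s t : ℝ} (hs : 0 ≤ s) (ht : 0 ≤ t) :
    m (s + t) 0 = L t (m s 0) + m t 0 := by
  have hm0 : m 0 0 = 0 := by rw [hmean 0 le_rfl, hdirac, integral_dirac]
  rcases hs.eq_or_lt with rfl | hs'
  · simp [hm0]
  rcases ht.eq_or_lt with rfl | ht'
  · simp [hm0, hL0]
  have hmarg : ∀ r > (0:ℝ), ∀ x h, (μ r x).map (fun y => ⟪y, h⟫_ℝ) =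
      gaussianReal ⟪m r x, h⟫_ℝ (⟪Q r x h, h⟫_ℝ).toNNReal := by
    intro r hr x h
    rw [(hgauss r hr x).map_inner_eq h, hcov r hr.le, hmean r hr.le]
  have : IsGaussian (μ s 0) := isGaussian_of_map_eq_gaussianReal (hgauss s hs' 0)
  have := hprob s hs 0
  have hint : Integrable (fun y : H => y) (μ s 0) := IsGaussian.integrable_id
  refine ext_inner_right ℝ fun h => ?_
  have hmeas : Measurable fun y : H => ⟪y, h⟫_ℝ := by fun_prop
  have hmix : ⟪m (s + t) 0, h⟫_ℝ = ∫ y, ⟪m t y, h⟫_ℝ ∂(μ s 0) := by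
    refine integral_mean_of_gaussianReal_mixture (μ s 0) (hyp2m t ht h).measurable
      (hyp2Q t ht h h).measurable.real_toNNReal (v' := (⟪Q (s + t) 0 h, h⟫_ℝ).toNNReal)
      fun B hB => ?_
    simp_rw [← hmarg t ht', ← hmarg (s + t) (add_pos hs' ht'), Measure.map_apply hmeas hB]
    exact hCK s hs t ht 0 _ (hmeas hB)
  have haff : ∀ y, m t y = L t y + m t 0 := fun y => by rw [hLdef t ht y]; abel
  have hLint : Integrable (fun y => L t y) (μ s 0) := (L t).integrable_comp hint
  have hmt : ∫ y, m t y ∂(μ s 0) = L t (m s 0) + m t 0 := by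
    rw [integral_congr_ae (ae_of_all _ haff), integral_add hLint (integrable_const _),
      (L t).integral_comp_comm hint, ← hmean s hs]
    simp
  have hmtint : Integrable (fun y => m t y) (μ s 0) := by
    rw [funext haff]; exact hLint.add (integrable_const _)
  rw [hmix, ← hmt, real_inner_comm, ← integral_inner hmtint h]
  simp_rw [real_inner_comm]

/-- Integrated form of `d/ds ⟨L(s)b, h⟩ = ⟨L(s)b, A*h⟩` for `h` in the domain of the adjoint
of the generator of a strongly continuous semigroup. -/
theorem integral_inner_adjoint_generator
    {H : Type*} [NormedAddCommGroup H] [InnerProductSpace ℝ H] [CompleteSpace H]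
    {L : ℝ → H →L[ℝ] H} (hL0 : L 0 = ContinuousLinearMap.id ℝ H)
    (hLsem : ∀ s ≥ (0:ℝ), ∀ t ≥ (0:ℝ), L (s + t) = (L s).comp (L t))
    (hLcont : ∀ x, ContinuousOn (fun t => L t x) (Ici 0)) {h Ah : H}
    (hderiv : HasDerivWithinAt (fun s => ContinuousLinearMap.adjoint (L s) h) Ah (Ici 0) 0)
    (b : H) {t : ℝ} (ht : 0 ≤ t) :
    ∫ s in (0:ℝ)..t, ⟪L s b, Ah⟫_ℝ = ⟪L t b, h⟫_ℝ - ⟪b, h⟫_ℝ := by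
  have hc : ∀ k : H, ContinuousOn (fun s => ⟪L s b, k⟫_ℝ) (Icc 0 t) := fun k =>
    ((hLcont b).mono Icc_subset_Ici_self).inner continuousOn_const
  have key := intervalIntegral.integral_eq_sub_of_hasDeriv_right_of_le
    (f := fun s => ⟪L s b, h⟫_ℝ) (f' := fun s => ⟪L s b, Ah⟫_ℝ) ht (hc h) ?_
    (ContinuousOn.intervalIntegrable (by rw [uIcc_of_le ht]; exact hc Ah))
  · simpa [hL0] using key
  intro s hs
  have hshift : HasDerivWithinAt (fun r => r - s) 1 (Ioi s) s :=
    ((hasDerivAt_id s).sub_const s).hasDerivWithinAt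
  have h0 : HasDerivWithinAt (fun r => ContinuousLinearMap.adjoint (L r) h) Ah (Ici 0)
      (s - s) := by rwa [sub_self]
  have h1 := h0.scomp (h := fun r => r - s) s hshift fun r (hr : s < r) => sub_nonneg.2 hr.le
  have h2 := (innerSL ℝ (L s b)).hasFDerivAt.comp_hasDerivWithinAt s h1
  simp only [one_smul, innerSL_apply_apply] at h2
  have heq : ∀ r, s ≤ r → ⟪L r b, h⟫_ℝ =
      ⟪L s b, ContinuousLinearMap.adjoint (L (r - s)) h⟫_ℝ := by
    intro r hr
    rw [ContinuousLinearMap.adjoint_inner_right, ← ContinuousLinearMap.comp_apply,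
      ← hLsem (r - s) (sub_nonneg.2 hr) s hs.1.le, sub_add_cancel]
  exact h2.congr (fun r (hr : s < r) => heq r hr.le) (heq s le_rfl)

/-- representation (2.3) of the mean: for `h ∈ dom(A*)`,
`⟨m(t,x),h⟩ = ⟨L(t)x,h⟩ + ∫₀ᵗ (λ⟨L(s)b_H,h⟩ − ⟨L(s)b_H,A*h⟩) ds`,
where `b_H = λ ∫₀^∞ e^{−λt} m(t,0) dt`. Membership `h ∈ dom(A*)` with value `A*h = Ah`
is expressed by right-differentiability at `0` of `s ↦ L(s)*h`. -/
theorem gauss_markov_mean_representation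
    {H : Type} [NormedAddCommGroup H] [InnerProductSpace ℝ H] [CompleteSpace H]
    [TopologicalSpace.SeparableSpace H] [MeasurableSpace H] [BorelSpace H]
    (μ : ℝ → H → Measure H) (m : ℝ → H → H) (Q : ℝ → H → H →L[ℝ] H)
    -- Gaussian transition family
    (hprob : ∀ t ≥ (0:ℝ), ∀ x, IsProbabilityMeasure (μ t x))
    (hdirac : ∀ x, μ 0 x = Measure.dirac x)
    (hgauss : ∀ t > (0:ℝ), ∀ x, IsGaussianMeasure (μ t x))
    (hmean : ∀ t ≥ (0:ℝ), ∀ x, m t x = ∫ y, y ∂(μ t x))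
    (hcov : ∀ t ≥ (0:ℝ), ∀ x, ∀ h k : H,
      ⟪Q t x h, k⟫_ℝ = ∫ y, ⟪y - m t x, h⟫_ℝ * ⟪y - m t x, k⟫_ℝ ∂(μ t x))
    (hCK : ∀ s ≥ (0:ℝ), ∀ t ≥ (0:ℝ), ∀ x, ∀ B : Set H, MeasurableSet B →
      μ (s + t) x B = ∫⁻ y, μ t y B ∂(μ s x))
    -- Hypothesis 2.1
    (hyp1m : ∀ (x h : H), ContinuousOn (fun t => ⟪m t x, h⟫_ℝ) (Ici 0))
    (hyp1Q : ∀ (x h k : H), ContinuousOn (fun t => ⟪Q t x h, k⟫_ℝ) (Ici 0))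
    (hyp2m : ∀ t ≥ (0:ℝ), ∀ h : H, Continuous (fun x => ⟪m t x, h⟫_ℝ))
    (hyp2Q : ∀ t ≥ (0:ℝ), ∀ h k : H, Continuous (fun x => ⟪Q t x h, k⟫_ℝ))
    (hyp3 : ∀ t > (0:ℝ), ∀ x, Dense (Set.range (Q t x)))
    -- L(t)x := m(t,x) − m(t,0) defines a C₀-semigroup
    (L : ℝ → H →L[ℝ] H)
    (hLdef : ∀ t ≥ (0:ℝ), ∀ x, L t x = m t x - m t 0)
    (hL0 : L 0 = ContinuousLinearMap.id ℝ H)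
    (hLsem : ∀ s ≥ (0:ℝ), ∀ t ≥ (0:ℝ), L (s + t) = (L s).comp (L t))
    (hLcont : ∀ x, ContinuousOn (fun t => L t x) (Ici 0))
    -- exponential bounds
    (M lam₀ : ℝ) (hM : 1 ≤ M) (hlam₀ : 0 < lam₀)
    (hLbound : ∀ t ≥ (0:ℝ), ‖L t‖ ≤ M * Real.exp (lam₀ * t))
    (hmbound : ∀ t ≥ (0:ℝ), ‖m t 0‖ ≤ M * Real.exp (lam₀ * t))
    -- λ > λ₀ and b_H := λ ∫₀^∞ e^{−λt} m(t,0) dt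
    (lam : ℝ) (hlam : lam₀ < lam) (bH : H)
    (hbH : bH = lam • ∫ t in Ioi (0:ℝ), Real.exp (-lam * t) • m t 0) :
    ∀ h Ah : H,
      HasDerivWithinAt (fun s => ContinuousLinearMap.adjoint (L s) h) Ah (Ici 0) 0 →
      ∀ x : H, ∀ t ≥ (0:ℝ),
        ⟪m t x, h⟫_ℝ =
          ⟪L t x, h⟫_ℝ + ∫ s in (0:ℝ)..t, (lam * ⟪L s bH, h⟫_ℝ - ⟪L s bH, Ah⟫_ℝ) := by
  intro h Ah hderiv x t ht
  have hlam_pos : 0 < lam := hlam₀.trans hlam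
  have hcocycle : ∀ s ≥ (0:ℝ), ∀ r ≥ (0:ℝ), L s (m r 0) = m (r + s) 0 - m s 0 := by
    intro s hs r hr
    rw [gaussian_transition_mean_cocycle hprob hdirac hgauss hmean hcov hCK hyp2m hyp2Q hLdef hL0
      hr hs, add_sub_cancel_right]
  let f : ℝ → ℝ := fun s => ⟪m s 0, h⟫_ℝ
  have hf0 : f 0 = 0 := by
    simp only [f]
    rw [hmean 0 le_rfl, hdirac, integral_dirac, inner_zero_left]
  have hmeas : Measurable fun u : ℝ => m (max u 0) 0 :=
    measurable_of_forall_measurable_inner fun k =>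
      ((hyp1m 0 k).comp_continuous (by fun_prop) fun u => le_max_right u 0).measurable
  have hint : IntegrableOn (fun r => Real.exp (-lam * r) • m r 0) (Ioi 0) := by
    refine Integrable.mono'
      ((integrableOn_exp_mul_Ioi (sub_neg.2 hlam) 0).const_mul M) ?_ ?_
    · refine AEStronglyMeasurable.congr (f := fun r => Real.exp (-lam * r) • m (max r 0) 0)
        (Measurable.smul (by fun_prop) hmeas).aestronglyMeasurable ?_
      filter_upwards [ae_restrict_mem measurableSet_Ioi] with r hr
      rw [max_eq_left (mem_Ioi.1 hr).le]
    · filter_upwards [ae_restrict_mem measurableSet_Ioi] with r hr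
      rw [norm_smul, Real.norm_of_nonneg (Real.exp_nonneg _)]
      calc Real.exp (-lam * r) * ‖m r 0‖
          ≤ Real.exp (-lam * r) * (M * Real.exp (lam₀ * r)) := by
            gcongr; exact hmbound r (mem_Ioi.1 hr).le
        _ = M * Real.exp ((lam₀ - lam) * r) := by
            rw [mul_left_comm, ← Real.exp_add]; ring_nf
  have hfint : IntegrableOn (fun u => Real.exp (-lam * u) * f u) (Ioi 0) := by
    simpa only [IntegrableOn, f, real_inner_smul_left] using hint.inner_const (𝕜 := ℝ) h
  set I := ∫ u in Ioi (0:ℝ), Real.exp (-lam * u) * f u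
  have hLb : ∀ s ≥ (0:ℝ), ⟪L s bH, h⟫_ℝ = lam * (Real.exp (lam * s) *
      (I - ∫ u in (0:ℝ)..s, Real.exp (-lam * u) * f u)) - f s := by
    intro s hs
    rw [← integral_exp_mul_shift_sub hlam_pos hfint hs, hbH, map_smul, real_inner_smul_left,
      ← (L s).integral_comp_comm hint, real_inner_comm,
      ← integral_inner ((L s).integrable_comp hint)]
    congr 1
    refine setIntegral_congr_fun measurableSet_Ioi fun r hr => ?_
    simp only [f, map_smul, real_inner_smul_right, hcocycle s hs r (mem_Ioi.1 hr).le,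
      inner_sub_right, real_inner_comm h]
  have hcont : ∀ k : H, IntervalIntegrable (fun s => ⟪L s bH, k⟫_ℝ) volume 0 t := fun k =>
    ContinuousOn.intervalIntegrable (by
      rw [uIcc_of_le ht]
      exact ((hLcont bH).mono Icc_subset_Ici_self).inner continuousOn_const)
  have hint_g : ∫ s in (0:ℝ)..t, ⟪L s bH, h⟫_ℝ =
      Real.exp (lam * t) * (I - ∫ u in (0:ℝ)..t, Real.exp (-lam * u) * f u) - I := by
    rw [← integral_resolvent_transform (hyp1m 0 h) lam I ht]
    refine intervalIntegral.integral_congr fun s hs => ?_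
    rw [uIcc_of_le ht] at hs
    exact hLb s hs.1
  have hb := hLb 0 le_rfl
  simp only [hL0, ContinuousLinearMap.id_apply, mul_zero, Real.exp_zero,
    intervalIntegral.integral_same, sub_zero, one_mul, hf0] at hb
  rw [intervalIntegral.integral_sub ((hcont h).const_mul lam) (hcont Ah),
    intervalIntegral.integral_const_mul, hint_g,
    integral_inner_adjoint_generator hL0 hLsem hLcont hderiv bH ht, hLb t ht, hb,
    hLdef t ht x, inner_sub_left]
  simp only [f]
  ring
end

section
/- Let {μ(t,x)} be a Gaussian transition family on H satisfying Hypothesis 2.1, and suppose L(t)x := m(t,x) − m(t,0) defines a C0-semigroup (L(t)) with generator A, and that Q(t) := Q(t,x) is independent of x. Then there exists a symmetric bilinear form B : dom(A*) × dom(A*) → ℝ with B(u,u) ≥ 0, continuous with respect to the graph norm (‖u‖² + ‖A*u‖²)^{1/2}, such that for every h ∈ dom(A*) and every t ≥ 0: ⟨Q(t)h,h⟩ = ∫₀ᵗ B(L(s)*h, L(s)*h) ds (note L(s)*h ∈ dom(A*) for h ∈ dom(A*)). Moreover, for every t ≥ 0 and every orthonormal basis (e_i) of H one has Σ_i ⟨Q(t)e_i,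 e_i⟩ < ∞. -/
open MeasureTheory ProbabilityTheory Set Filter
open scoped InnerProductSpace NNReal

section GaussianMeasures

variable {H : Type*} [NormedAddCommGroup H] [InnerProductSpace ℝ H] [CompleteSpace H]
  [MeasurableSpace H] [BorelSpace H]

/-- The covariance form of a measure with finite second moment has finite trace. -/
lemma summable_covarianceBilin_of_orthonormal {μ : Measure H} [IsFiniteMeasure μ]
    (hμ : MemLp id 2 μ) {ι : Type*} {e : ι → H} (he : Orthonormal ℝ e) :
    Summable fun i ↦ covarianceBilin μ (e i) (e i) := by
  have hsub : MemLp (fun z ↦ z - μ[id]) 2 μ := hμ.sub (memLp_const _)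
  refine summable_of_sum_le (c := ∫ z, ‖z - μ[id]‖ ^ 2 ∂μ)
    (fun i ↦ covarianceBilin_self_nonneg _) fun s ↦ ?_
  simp_rw [covarianceBilin_apply hμ, ← sq]
  have hint : ∀ i, Integrable (fun z ↦ inner ℝ (e i) (z - μ[id]) ^ 2) μ := fun i ↦
    (hsub.const_inner (e i)).integrable_sq
  rw [← integral_finsetSum _ fun i _ ↦ hint i]
  refine integral_mono (integrable_finsetSum _ fun i _ ↦ hint i)
    (hsub.integrable_norm_pow (by norm_num)) fun z ↦ ?_
  simpa using he.sum_inner_products_le (z - μ[id]) (s := s)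

variable [SecondCountableTopology H]

/-- Covariances of Gaussian measures add up under convolution. -/
lemma covarianceBilin_conv_self_of_isGaussian (μ ν : Measure H) [IsGaussian μ] [IsGaussian ν]
    (h : H) :
    covarianceBilin (μ.conv ν) h h = covarianceBilin μ h h + covarianceBilin ν h h := by
  have key := congrArg norm (charFun_conv (μ := μ) (ν := ν) h)
  simp only [IsGaussian.charFun_eq', norm_mul, Complex.norm_exp, ← Real.exp_add] at key
  have := Real.exp_injective key
  simp only [Complex.sub_re, Complex.re_ofReal_mul, Complex.I_re, mul_zero, zero_sub,
    Complex.div_ofNat_re, Complex.ofReal_re] at this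
  linarith

/-- Two Gaussian measures with the same covariance are translates of each other. -/
lemma eq_map_const_add_of_isGaussian {μ ν : Measure H} [IsGaussian μ] [IsGaussian ν]
    (hcov : ∀ h, covarianceBilin ν h h = covarianceBilin μ h h) :
    ν = μ.map (fun y ↦ (ν[id] - μ[id]) + y) := by
  refine Measure.ext_of_charFun (funext fun h ↦ ?_)
  rw [charFun_map_const_add, IsGaussian.charFun_eq', IsGaussian.charFun_eq', hcov,
    ← Complex.exp_add, inner_sub_left, real_inner_comm h, real_inner_comm h]
  congr 1
  push_cast
  ring

end GaussianMeasures

section QuadraticCocycle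

variable {H : Type*} [NormedAddCommGroup H] [NormedSpace ℝ H]

/-- A pointwise continuous family of bilinear forms that is nonnegative and increasing on the
diagonal can be averaged over `[0, 1]`. -/
lemma exists_integral_bilin {q : ℝ → H →L[ℝ] H →L[ℝ] ℝ}
    (hsymm : ∀ t ≥ 0, ∀ u v, q t u v = q t v u) (hpos : ∀ t ≥ 0, ∀ u, 0 ≤ q t u u)
    (hmono : ∀ t ∈ Icc (0 : ℝ) 1, ∀ u, q t u u ≤ q 1 u u)
    (hcont : ∀ u v, ContinuousOn (fun t ↦ q t u v) (Ici 0)) :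
    ∃ b : H →L[ℝ] H →L[ℝ] ℝ, ∀ u v, b u v = ∫ s in (0 : ℝ)..1, q s u v := by
  have hint : ∀ u v, IntervalIntegrable (fun s ↦ q s u v) volume 0 1 := fun u v ↦
    ((hcont u v).mono (by rw [uIcc_of_le zero_le_one]; exact Icc_subset_Ici_self)).intervalIntegrable
  have hbound : ∀ s ∈ Icc (0 : ℝ) 1, ∀ u v, |q s u v| ≤ ‖q 1‖ * ‖u‖ * ‖v‖ := by
    intro s hs u v
    have h1 : ∀ w, q s w w ≤ ‖q 1‖ * ‖w‖ * ‖w‖ := fun w ↦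
      (hmono s hs w).trans ((le_abs_self _).trans ((q 1).le_opNorm₂ w w))
    have cs : q s u v ^ 2 ≤ q s u u * q s v v :=
      LinearMap.BilinForm.apply_sq_le_of_symm (q s).toBilinForm (hpos s hs.1)
        ⟨fun x y ↦ hsymm s hs.1 x y⟩ u v
    refine abs_le_of_sq_le_sq (cs.trans ?_) (by positivity)
    calc q s u u * q s v v ≤ (‖q 1‖ * ‖u‖ * ‖u‖) * (‖q 1‖ * ‖v‖ * ‖v‖) :=
          mul_le_mul (h1 u) (h1 v) (hpos s hs.1 v) (by positivity)
      _ = (‖q 1‖ * ‖u‖ * ‖v‖) ^ 2 := by ring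
  let f : H →ₗ[ℝ] H →ₗ[ℝ] ℝ := LinearMap.mk₂ ℝ (fun u v ↦ ∫ s in (0 : ℝ)..1, q s u v)
    (fun u u' v ↦ by
      simp only [map_add, add_apply]
      exact intervalIntegral.integral_add (hint u v) (hint u' v))
    (fun c u v ↦ by simp)
    (fun u v v' ↦ by
      simp only [map_add]
      exact intervalIntegral.integral_add (hint u v) (hint u v'))
    (fun c u v ↦ by simp)
  refine ⟨f.mkContinuous₂ ‖q 1‖ fun u v ↦ ?_, fun u v ↦ rfl⟩
  have := intervalIntegral.norm_integral_le_of_norm_le_const (a := 0) (b := 1)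
    (f := fun s ↦ q s u v) (C := ‖q 1‖ * ‖u‖ * ‖v‖) fun s hs ↦ by
      rw [uIoc_of_le zero_le_one] at hs
      exact hbound s (Ioc_subset_Icc_self hs) u v
  simpa [f] using this

variable {q : ℝ → H →L[ℝ] H →L[ℝ] ℝ} {T : ℝ → H →L[ℝ] H}

/-- For `q (t + s) = q t + q s ∘ T t`, the function `t ↦ q t h h` is right-differentiable at `0`
whenever the orbit `t ↦ T t h` is. -/
lemma hasDerivWithinAt_cocycle {b : H →L[ℝ] H →L[ℝ] ℝ}
    (hb : ∀ u v, b u v = ∫ s in (0 : ℝ)..1, q s u v)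
    (hcont : ∀ u v, ContinuousOn (fun t ↦ q t u v) (Ici 0))
    (hadd : ∀ t ≥ 0, ∀ s ≥ 0, ∀ h, q (t + s) h h = q t h h + q s (T t h) (T t h))
    (hT0 : T 0 = ContinuousLinearMap.id ℝ H) {h Ah : H}
    (hd : HasDerivWithinAt (fun s ↦ T s h) Ah (Ici 0) 0) :
    HasDerivWithinAt (fun t ↦ q t h h) (q 1 h h - b h Ah - b Ah h) (Ici 0) 0 := by
  have hq0 : q 0 h h = 0 := by
    have := hadd 0 le_rfl 0 le_rfl h
    simp only [hT0, add_zero, ContinuousLinearMap.id_apply] at this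
    linarith
  have hint : ∀ u, IntervalIntegrable (fun s ↦ q s u u) volume 0 1 := fun u ↦
    ((hcont u u).mono (by rw [uIcc_of_le zero_le_one]; exact Icc_subset_Ici_self)).intervalIntegrable
  set f : ℝ → ℝ := fun s ↦ q (max s 0) h h with hf
  have hfc : Continuous f :=
    (hcont h h).comp_continuous (continuous_id.max continuous_const) fun s ↦ le_max_right s 0
  have hfeq : ∀ s ≥ 0, f s = q s h h := fun s hs ↦ by simp only [hf, max_eq_left hs]
  set P : ℝ → ℝ := fun t ↦ ∫ s in (0 : ℝ)..t, f s
  have hP : ∀ t, HasDerivAt P (f t) t := fun t ↦ (hfc.integral_hasStrictDerivAt 0 t).hasDerivAt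
  have heq : ∀ t ∈ Ici (0 : ℝ), q t h h = P (t + 1) - P t - b (T t h) (T t h) := by
    intro t ht
    have h1 : P (t + 1) - P t = ∫ s in (0 : ℝ)..1, f (t + s) := by
      rw [intervalIntegral.integral_comp_add_left, add_zero]
      exact intervalIntegral.integral_interval_sub_left (hfc.intervalIntegrable _ _)
        (hfc.intervalIntegrable _ _)
    have h2 : ∫ s in (0 : ℝ)..1, f (t + s) =
        ∫ s in (0 : ℝ)..1, (q t h h + q s (T t h) (T t h)) := by
      refine intervalIntegral.integral_congr fun s hs ↦ ?_
      rw [uIcc_of_le zero_le_one] at hs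
      rw [hfeq _ (add_nonneg ht hs.1), hadd t ht s hs.1]
    rw [h1, h2, intervalIntegral.integral_add intervalIntegrable_const (hint _), hb]
    simp
  have hP1 : HasDerivAt (fun t ↦ P (t + 1)) (f (0 + 1)) 0 := (hP (0 + 1)).comp_add_const 0 1
  have hder := ((hP1.sub (hP 0)).hasDerivWithinAt (s := Ici 0)).sub
    (ContinuousLinearMap.hasDerivWithinAt_of_bilinear (B := b) hd hd)
  refine (hder.congr heq (heq 0 self_mem_Ici)).congr_deriv ?_
  simp only [hT0, ContinuousLinearMap.id_apply, zero_add, hfeq 1 zero_le_one, hfeq 0 le_rfl, hq0]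
  ring

/-- The right derivative at `0` of a function that is nonnegative on `[0, ∞)` and vanishes at `0`
is nonnegative. -/
lemma nonneg_of_hasDerivWithinAt_Ici {f : ℝ → ℝ} {f' : ℝ} (hf : ∀ t ≥ 0, 0 ≤ f t) (hf0 : f 0 = 0)
    (hd : HasDerivWithinAt f f' (Ici 0) 0) : 0 ≤ f' := by
  have h := (hasDerivWithinAt_iff_tendsto_slope' self_notMem_Ioi).1 hd.Ioi_of_Ici
  refine ge_of_tendsto h ?_
  filter_upwards [self_mem_nhdsWithin] with t ht
  rw [slope_def_field, hf0, sub_zero, sub_zero]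
  exact div_nonneg (hf t (le_of_lt ht)) (le_of_lt ht)

/-- A nonnegative quadratic cocycle over a semigroup `T` is the integral along orbits in the domain
of the generator of a nonnegative symmetric form which is bounded for the graph norm. -/
theorem exists_bilin_cocycle_eq_integral
    (hsymm : ∀ t ≥ 0, ∀ u v, q t u v = q t v u) (hpos : ∀ t ≥ 0, ∀ u, 0 ≤ q t u u)
    (hcont : ∀ u v, ContinuousOn (fun t ↦ q t u v) (Ici 0))
    (hadd : ∀ t ≥ 0, ∀ s ≥ 0, ∀ h, q (t + s) h h = q t h h + q s (T t h) (T t h))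
    (hT0 : T 0 = ContinuousLinearMap.id ℝ H)
    (hTsem : ∀ s ≥ 0, ∀ t ≥ 0, T (s + t) = (T s).comp (T t)) :
    ∃ B : H → H → ℝ,
      (∀ u v, B u v = B v u) ∧
      (∀ u Au v Av w Aw : H, HasDerivWithinAt (fun s ↦ T s u) Au (Ici 0) 0 →
        HasDerivWithinAt (fun s ↦ T s v) Av (Ici 0) 0 →
        HasDerivWithinAt (fun s ↦ T s w) Aw (Ici 0) 0 → B (u + v) w = B u w + B v w) ∧
      (∀ (c : ℝ) (u Au v Av : H), HasDerivWithinAt (fun s ↦ T s u) Au (Ici 0) 0 →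
        HasDerivWithinAt (fun s ↦ T s v) Av (Ici 0) 0 → B (c • u) v = c * B u v) ∧
      (∀ u Au : H, HasDerivWithinAt (fun s ↦ T s u) Au (Ici 0) 0 → 0 ≤ B u u) ∧
      (∃ c > (0 : ℝ), ∀ u Au v Av : H, HasDerivWithinAt (fun s ↦ T s u) Au (Ici 0) 0 →
        HasDerivWithinAt (fun s ↦ T s v) Av (Ici 0) 0 →
        |B u v| ≤ c * √(‖u‖ ^ 2 + ‖Au‖ ^ 2) * √(‖v‖ ^ 2 + ‖Av‖ ^ 2)) ∧
      (∀ h Ah : H, HasDerivWithinAt (fun s ↦ T s h) Ah (Ici 0) 0 →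
        ∀ t ≥ (0 : ℝ), q t h h = ∫ s in (0 : ℝ)..t, B (T s h) (T s h)) := by
  have hq0 : ∀ h, q 0 h h = 0 := fun h ↦ by
    have := hadd 0 le_rfl 0 le_rfl h
    simp only [hT0, add_zero, ContinuousLinearMap.id_apply] at this
    linarith
  have hmono : ∀ t ∈ Icc (0 : ℝ) 1, ∀ u, q t u u ≤ q 1 u u := fun t ht u ↦ by
    have h1 := hadd t ht.1 (1 - t) (sub_nonneg.2 ht.2) u
    rw [add_sub_cancel] at h1
    linarith [hpos (1 - t) (sub_nonneg.2 ht.2) (T t u)]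
  obtain ⟨b, hb⟩ := exists_integral_bilin hsymm hpos hmono hcont
  have hbsymm : ∀ u v, b u v = b v u := fun u v ↦ by
    rw [hb, hb]
    refine intervalIntegral.integral_congr fun s hs ↦ ?_
    rw [uIcc_of_le zero_le_one] at hs
    exact hsymm s hs.1 u v
  set A : H → H := fun u ↦ derivWithin (fun s ↦ T s u) (Ici 0) 0
  have hA : ∀ {u Au : H}, HasDerivWithinAt (fun s ↦ T s u) Au (Ici 0) 0 → A u = Au := fun hd ↦
    hd.derivWithin (uniqueDiffOn_Ici 0 0 self_mem_Ici)
  set B : H → H → ℝ := fun u v ↦ q 1 u v - b u (A v) - b (A u) v with hB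
  have hderiv : ∀ {u Au : H}, HasDerivWithinAt (fun s ↦ T s u) Au (Ici 0) 0 →
      HasDerivWithinAt (fun t ↦ q t u u) (B u u) (Ici 0) 0 := fun {u Au} hd ↦ by
    simpa only [hB, hA hd] using hasDerivWithinAt_cocycle hb hcont hadd hT0 hd
  have hBnonneg : ∀ {u Au : H}, HasDerivWithinAt (fun s ↦ T s u) Au (Ici 0) 0 → 0 ≤ B u u :=
    fun {u Au} hd ↦ nonneg_of_hasDerivWithinAt_Ici (fun t ht ↦ hpos t ht u) (hq0 u) (hderiv hd)
  have horbit : ∀ {h Ah : H}, HasDerivWithinAt (fun s ↦ T s h) Ah (Ici 0) 0 → ∀ t ≥ 0,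
      HasDerivWithinAt (fun s ↦ T s (T t h)) (T t Ah) (Ici 0) 0 := by
    intro h Ah hd t ht
    have hcomm : ∀ s ∈ Ici (0 : ℝ), T s (T t h) = T t (T s h) := fun s hs ↦ by
      rw [← ContinuousLinearMap.comp_apply, ← ContinuousLinearMap.comp_apply, ← hTsem s hs t ht,
        ← hTsem t ht s hs, add_comm]
    exact ((T t).hasFDerivAt.comp_hasDerivWithinAt 0 hd).congr hcomm (hcomm 0 self_mem_Ici)
  refine ⟨B, fun u v ↦ ?_, fun u Au v Av w Aw hu hv hw ↦ ?_, fun c u Au v Av hu hv ↦ ?_,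
    fun u Au hu ↦ hBnonneg hu, ⟨‖q 1‖ + 2 * ‖b‖ + 1, by positivity, fun u Au v Av hu hv ↦ ?_⟩,
    fun h Ah hd t ht ↦ ?_⟩
  · simp only [hB]
    rw [hsymm 1 zero_le_one, hbsymm u, hbsymm (A u)]
    ring
  · have huv : A (u + v) = Au + Av := hA ((hu.add hv).congr_of_eventuallyEq
      (.of_forall fun s ↦ map_add _ _ _) (map_add _ _ _))
    simp only [hB, huv, hA hu, hA hv, map_add, add_apply]
    ring
  · have hcu : A (c • u) = c • Au := hA ((hu.const_smul c).congr_of_eventuallyEq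
      (.of_forall fun s ↦ map_smul _ _ _) (map_smul _ _ _))
    simp only [hB, hcu, hA hu, map_smul, smul_apply, smul_eq_mul]
    ring
  · have hle : ∀ x y : H, ‖x‖ ≤ √(‖x‖ ^ 2 + ‖y‖ ^ 2) ∧ ‖y‖ ≤ √(‖x‖ ^ 2 + ‖y‖ ^ 2) := fun x y ↦
      ⟨Real.le_sqrt_of_sq_le (by nlinarith [sq_nonneg ‖y‖]),
        Real.le_sqrt_of_sq_le (by nlinarith [sq_nonneg ‖x‖])⟩
    obtain ⟨hu1, hu2⟩ := hle u Au
    obtain ⟨hv1, hv2⟩ := hle v Av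
    set X := √(‖u‖ ^ 2 + ‖Au‖ ^ 2)
    set Y := √(‖v‖ ^ 2 + ‖Av‖ ^ 2)
    have hbilin : ∀ (g : H →L[ℝ] H →L[ℝ] ℝ) {x y : H}, ‖x‖ ≤ X → ‖y‖ ≤ Y →
        |g x y| ≤ ‖g‖ * X * Y := fun g x y hx hy ↦
      (g.le_opNorm₂ x y).trans (by gcongr)
    simp only [hB, hA hu, hA hv]
    have hXY : 0 ≤ X * Y := by positivity
    calc |q 1 u v - b u Av - b Au v| ≤ |q 1 u v| + |b u Av| + |b Au v| :=
          (abs_sub _ _).trans (add_le_add_left (abs_sub _ _) _)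
      _ ≤ ‖q 1‖ * X * Y + ‖b‖ * X * Y + ‖b‖ * X * Y :=
          add_le_add_three (hbilin _ hu1 hv1) (hbilin _ hu1 hv2) (hbilin _ hu2 hv1)
      _ ≤ (‖q 1‖ + 2 * ‖b‖ + 1) * X * Y := by linarith
  · have hc : ContinuousOn (fun t ↦ q t h h) (Icc 0 t) := (hcont h h).mono Icc_subset_Ici_self
    have hright : ∀ x ∈ Ioo 0 t,
        HasDerivWithinAt (fun t ↦ q t h h) (B (T x h) (T x h)) (Ioi x) x := by
      intro x hx
      have h0 : HasDerivWithinAt (fun s ↦ q s (T x h) (T x h)) (B (T x h) (T x h)) (Ici 0)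
          (x - x) := by
        simpa using hderiv (horbit hd x hx.1.le)
      have h1 := (h0.scomp x (h := fun y ↦ y - x) ((hasDerivAt_id x).sub_const x).hasDerivWithinAt
        (s := Ioi x) (fun y hy ↦ mem_Ici.2 (sub_nonneg.2 (le_of_lt hy)))).const_add (q x h h)
      rw [one_smul] at h1
      have heq : ∀ y ∈ Ici x, q y h h = q x h h + q (y - x) (T x h) (T x h) := fun y hy ↦ by
        rw [← hadd x hx.1.le (y - x) (sub_nonneg.2 hy), add_sub_cancel]
      exact h1.congr (fun y hy ↦ heq y (Ioi_subset_Ici_self hy)) (heq x self_mem_Ici)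
    have hint : IntervalIntegrable (fun s ↦ B (T s h) (T s h)) volume 0 t :=
      (intervalIntegrable_iff_integrableOn_Ioc_of_le ht).2
        (intervalIntegral.integrableOn_deriv_right_of_nonneg hc hright
          fun x hx ↦ hBnonneg (horbit hd x hx.1.le))
    rw [intervalIntegral.integral_eq_sub_of_hasDeriv_right_of_le ht hc hright hint, hq0, sub_zero]

end QuadraticCocycle

/-- representation (2.5) of the covariance: there is a nonnegative symmetric
bilinear form `B` on `dom(A*)`, continuous for the graph norm, with
`⟨Q(t)h,h⟩ = ∫₀ᵗ B(L(s)*h, L(s)*h) ds` for `h ∈ dom(A*)`, and `Q(t)` is trace class.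
Membership `h ∈ dom(A*)` with `A*h = Ah` is expressed by right-differentiability at `0`
of `s ↦ L(s)*h`. -/
theorem gauss_markov_covariance_representation
    {H : Type} [NormedAddCommGroup H] [InnerProductSpace ℝ H] [CompleteSpace H]
    [TopologicalSpace.SeparableSpace H] [MeasurableSpace H] [BorelSpace H]
    (μ : ℝ → H → Measure H) (m : ℝ → H → H) (Q : ℝ → H → H →L[ℝ] H)
    -- Gaussian transition family
    (hprob : ∀ t ≥ (0:ℝ), ∀ x, IsProbabilityMeasure (μ t x))
    (hdirac : ∀ x, μ 0 x = Measure.dirac x)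
    (hgauss : ∀ t > (0:ℝ), ∀ x, IsGaussianMeasure (μ t x))
    (hmean : ∀ t ≥ (0:ℝ), ∀ x, m t x = ∫ y, y ∂(μ t x))
    (hcov : ∀ t ≥ (0:ℝ), ∀ x, ∀ h k : H,
      ⟪Q t x h, k⟫_ℝ = ∫ y, ⟪y - m t x, h⟫_ℝ * ⟪y - m t x, k⟫_ℝ ∂(μ t x))
    (hCK : ∀ s ≥ (0:ℝ), ∀ t ≥ (0:ℝ), ∀ x, ∀ B : Set H, MeasurableSet B →
      μ (s + t) x B = ∫⁻ y, μ t y B ∂(μ s x))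
    -- Hypothesis 2.1
    (hyp1m : ∀ (x h : H), ContinuousOn (fun t => ⟪m t x, h⟫_ℝ) (Ici 0))
    (hyp1Q : ∀ (x h k : H), ContinuousOn (fun t => ⟪Q t x h, k⟫_ℝ) (Ici 0))
    (hyp2m : ∀ t ≥ (0:ℝ), ∀ h : H, Continuous (fun x => ⟪m t x, h⟫_ℝ))
    (hyp2Q : ∀ t ≥ (0:ℝ), ∀ h k : H, Continuous (fun x => ⟪Q t x h, k⟫_ℝ))
    (hyp3 : ∀ t > (0:ℝ), ∀ x, Dense (Set.range (Q t x)))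
    -- L(t)x := m(t,x) − m(t,0) defines a C₀-semigroup
    (L : ℝ → H →L[ℝ] H)
    (hLdef : ∀ t ≥ (0:ℝ), ∀ x, L t x = m t x - m t 0)
    (hL0 : L 0 = ContinuousLinearMap.id ℝ H)
    (hLsem : ∀ s ≥ (0:ℝ), ∀ t ≥ (0:ℝ), L (s + t) = (L s).comp (L t))
    (hLcont : ∀ x, ContinuousOn (fun t => L t x) (Ici 0))
    -- Q(t) := Q(t,x) is independent of x
    (hQind : ∀ t ≥ (0:ℝ), ∀ x y, Q t x = Q t y) :
    ∃ B : H → H → ℝ,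
      -- symmetric on dom(A*)
      (∀ u Au v Av : H,
        HasDerivWithinAt (fun s => ContinuousLinearMap.adjoint (L s) u) Au (Ici 0) 0 →
        HasDerivWithinAt (fun s => ContinuousLinearMap.adjoint (L s) v) Av (Ici 0) 0 →
        B u v = B v u) ∧
      -- bilinear on dom(A*)
      (∀ u Au v Av w Aw : H,
        HasDerivWithinAt (fun s => ContinuousLinearMap.adjoint (L s) u) Au (Ici 0) 0 →
        HasDerivWithinAt (fun s => ContinuousLinearMap.adjoint (L s) v) Av (Ici 0) 0 →
        HasDerivWithinAt (fun s => ContinuousLinearMap.adjoint (L s) w) Aw (Ici 0) 0 →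
        B (u + v) w = B u w + B v w) ∧
      (∀ (c : ℝ) (u Au v Av : H),
        HasDerivWithinAt (fun s => ContinuousLinearMap.adjoint (L s) u) Au (Ici 0) 0 →
        HasDerivWithinAt (fun s => ContinuousLinearMap.adjoint (L s) v) Av (Ici 0) 0 →
        B (c • u) v = c * B u v) ∧
      -- nonnegative on dom(A*)
      (∀ u Au : H,
        HasDerivWithinAt (fun s => ContinuousLinearMap.adjoint (L s) u) Au (Ici 0) 0 →
        0 ≤ B u u) ∧
      -- continuous with respect to the graph norm of A*
      (∃ c > (0:ℝ), ∀ u Au v Av : H,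
        HasDerivWithinAt (fun s => ContinuousLinearMap.adjoint (L s) u) Au (Ici 0) 0 →
        HasDerivWithinAt (fun s => ContinuousLinearMap.adjoint (L s) v) Av (Ici 0) 0 →
        |B u v| ≤ c * Real.sqrt (‖u‖ ^ 2 + ‖Au‖ ^ 2) * Real.sqrt (‖v‖ ^ 2 + ‖Av‖ ^ 2)) ∧
      -- the representation of the covariance
      (∀ h Ah : H,
        HasDerivWithinAt (fun s => ContinuousLinearMap.adjoint (L s) h) Ah (Ici 0) 0 →
        ∀ t ≥ (0:ℝ), ⟪Q t 0 h, h⟫_ℝ =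
          ∫ s in (0:ℝ)..t,
            B (ContinuousLinearMap.adjoint (L s) h) (ContinuousLinearMap.adjoint (L s) h)) ∧
      -- Q(t) is of trace class
      (∀ t ≥ (0:ℝ), ∀ (ι : Type) (e : HilbertBasis ι ℝ H),
        Summable (fun i => ⟪Q t 0 (e i), e i⟫_ℝ)) := by
  have : SecondCountableTopology H := UniformSpace.secondCountable_of_separable H
  have hG : ∀ t ≥ (0 : ℝ), ∀ x, IsGaussian (μ t x) := fun t ht x ↦ by
    rcases ht.eq_or_lt with rfl | ht
    · rw [hdirac]
      infer_instance
    · exact isGaussian_of_map_eq_gaussianReal (hgauss t ht x)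
  have hcb : ∀ t ≥ (0 : ℝ), ∀ x h k, covarianceBilin (μ t x) h k = ⟪Q t x h, k⟫_ℝ := by
    intro t ht x h k
    have := hG t ht x
    rw [covarianceBilin_apply IsGaussian.memLp_two_id, hcov t ht x h k, hmean t ht x]
    simp only [id, real_inner_comm]
  have htranslate : ∀ t ≥ (0 : ℝ), ∀ x, μ t x = (μ t 0).map (fun y ↦ L t x + y) := by
    intro t ht x
    have := hG t ht x
    have := hG t ht 0
    have h1 := eq_map_const_add_of_isGaussian (μ := μ t 0) (ν := μ t x) fun h ↦ by
      rw [hcb t ht, hcb t ht, hQind t ht x 0]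
    simp only [id] at h1
    rwa [← hmean t ht, ← hmean t ht, ← hLdef t ht] at h1
  have hconv : ∀ s ≥ (0 : ℝ), ∀ t ≥ (0 : ℝ), μ (s + t) 0 = ((μ s 0).map (L t)).conv (μ t 0) := by
    intro s hs t ht
    have := hprob t ht 0
    ext A hA
    rw [hCK s hs t ht 0 A hA, ← lintegral_indicator_one hA,
      Measure.lintegral_conv (measurable_one.indicator hA),
      lintegral_map _ (L t).continuous.measurable]
    · refine lintegral_congr fun y ↦ ?_
      rw [htranslate t ht y, ← lintegral_indicator_one hA,
        lintegral_map (measurable_one.indicator hA) (measurable_const_add _)]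
    · exact Measurable.lintegral_prod_right
        ((measurable_one.indicator hA).comp measurable_add)
  obtain ⟨B, hB1, hB2, hB3, hB4, hB5, hB6⟩ := exists_bilin_cocycle_eq_integral
    (q := fun t ↦ covarianceBilin (μ t 0)) (T := fun t ↦ ContinuousLinearMap.adjoint (L t))
    (fun t _ ↦ covarianceBilin_comm) (fun t _ ↦ covarianceBilin_self_nonneg)
    (fun u v ↦ (hyp1Q 0 u v).congr fun t ht ↦ hcb t ht 0 u v)
    (fun t ht s hs h ↦ by
      have := hG t ht 0
      have := hG s hs 0
      rw [add_comm t s, hconv s hs t ht, covarianceBilin_conv_self_of_isGaussian,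
        covarianceBilin_map IsGaussian.memLp_two_id, add_comm])
    (by simp [hL0, ← ContinuousLinearMap.one_def, ← ContinuousLinearMap.star_eq_adjoint])
    (fun s hs t ht ↦ by rw [add_comm, hLsem t ht s hs, ContinuousLinearMap.adjoint_comp])
  refine ⟨B, fun u _ v _ _ _ ↦ hB1 u v, hB2, hB3, hB4, hB5, fun h Ah hd t ht ↦ ?_,
    fun t ht ι e ↦ ?_⟩
  · rw [← hcb t ht]
    exact hB6 h Ah hd t ht
  · have := hG t ht 0
    simpa only [hcb t ht] using
      summable_covarianceBilin_of_orthonormal (μ := μ t 0) IsGaussian.memLp_two_id e.orthonormal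
end

section
/- Let (L(t)) be a C0-semigroup on H with generator A, let λ > 0, b_H ∈ H, and let B be a symmetric nonnegative bilinear form on dom(A*). Let {μ(t,x)} be Gaussian measures on H with mean m(t,x) and covariance Q(t) satisfying, for all h ∈ dom(A*), x ∈ H, t ≥ 0: ⟨m(t,x),h⟩ = ⟨L(t)x,h⟩ + ∫₀ᵗ (λ⟨L(s)b_H,h⟩ − ⟨L(s)b_H,A*h⟩) ds and ⟨Q(t)h,h⟩ = ∫₀ᵗ B(L(s)*h, L(s)*h) ds, with Σ_i ⟨Q(t)e_i,e_i⟩ < ∞ for an orthonormal basis (e_i). Let n ≥ 1, f ∈ C_b^∞(ℝⁿ), h₁,…,h_n ∈ dom(A*), and let φ(x) = f(⟨x,h₁⟩,…,⟨x,h_n⟩) satisfy sup_{x∈H} |Σ_i ⟨x, A*h_i⟩ ∂_i f(⟨x,h₁⟩,…,⟨x,h_n⟩)| < ∞. Then for every x ∈ H: lim_{t↓0} (1/t)( ∫_H φ dμ(t,x) − φ(x) ) = (1/2) Σ_{i,j} B(h_i,h_j) ∂_i∂_j f(⟨x,h₁⟩,…,⟨x,h_n⟩) + Σ_i ( ⟨x,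 A*h_i⟩ + λ⟨b_H,h_i⟩ − ⟨b_H, A*h_i⟩ ) ∂_i f(⟨x,h₁⟩,…,⟨x,h_n⟩). -/
open MeasureTheory ProbabilityTheory Set Filter
open scoped InnerProductSpace NNReal

set_option maxSynthPendingDepth 3 in
theorem taylor_two_remainder_le {E : Type*} [NormedAddCommGroup E] [NormedSpace ℝ E]
    {f : E → ℝ} (hf : ContDiff ℝ 3 f) {C : ℝ}
    (hC : ∀ z, ‖iteratedFDeriv ℝ 3 f z‖ ≤ C) (z v : E) :
    |f (z + v) - f z - fderiv ℝ f z v - (1 / 2) * fderiv ℝ (fderiv ℝ f) z v v| ≤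
      C * ‖v‖ ^ 3 := by
  have hf1 : ContDiff ℝ 2 (fderiv ℝ f) := hf.fderiv_right (by norm_num)
  have hf2 : ContDiff ℝ 1 (fderiv ℝ (fderiv ℝ f)) := hf1.fderiv_right (by norm_num)
  have hC' : ∀ z, ‖fderiv ℝ (fderiv ℝ (fderiv ℝ f)) z‖ ≤ C := fun z => by
    rw [← norm_iteratedFDeriv_zero (𝕜 := ℝ) (f := fderiv ℝ (fderiv ℝ (fderiv ℝ f))),
      norm_iteratedFDeriv_fderiv, norm_iteratedFDeriv_fderiv, norm_iteratedFDeriv_fderiv]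
    exact hC z
  have hC0 : 0 ≤ C := (norm_nonneg _).trans (hC z)
  have h2 : ∀ u, ‖fderiv ℝ (fderiv ℝ f) (z + u) - fderiv ℝ (fderiv ℝ f) z‖ ≤ C * ‖u‖ :=
    fun u => by
      simpa using convex_univ.norm_image_sub_le_of_norm_fderiv_le (𝕜 := ℝ)
        (fun x _ => (hf2.differentiable (by norm_num)) x) (fun x _ => hC' x)
        (mem_univ z) (mem_univ (z + u))
  have hz : ∀ u : E, HasFDerivAt (fun u => z + u) (ContinuousLinearMap.id ℝ E) u :=
    fun u => (hasFDerivAt_id u).const_add z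
  have hsymm : IsSymmSndFDerivAt ℝ f z :=
    hf.contDiffAt.isSymmSndFDerivAt (by
      simp only [minSmoothness_of_isRCLikeNormedField]; norm_num)
  have hball : ∀ u ∈ Metric.closedBall (0 : E) ‖v‖, ‖u‖ ≤ ‖v‖ := fun u hu => by simpa using hu
  have h0 : (0 : E) ∈ Metric.closedBall (0 : E) ‖v‖ := by simp
  have hconv := convex_closedBall (0 : E) ‖v‖
  have h1 : ∀ u ∈ Metric.closedBall (0 : E) ‖v‖,
      ‖fderiv ℝ f (z + u) - fderiv ℝ f z - fderiv ℝ (fderiv ℝ f) z u‖ ≤ C * ‖v‖ * ‖v‖ := by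
    intro u hu
    have hd : ∀ u, HasFDerivAt
        (fun u => fderiv ℝ f (z + u) - fderiv ℝ f z - fderiv ℝ (fderiv ℝ f) z u)
        (fderiv ℝ (fderiv ℝ f) (z + u) - fderiv ℝ (fderiv ℝ f) z) u := fun u => by
      have hd1 := ((hf1.differentiable (by norm_num)) (z + u)).hasFDerivAt.comp u (hz u)
      exact (hd1.sub_const _).sub (fderiv ℝ (fderiv ℝ f) z).hasFDerivAt
    have := hconv.norm_image_sub_le_of_norm_hasFDerivWithin_le
      (fun x _ => (hd x).hasFDerivWithinAt)
      (fun x hx => (h2 x).trans (mul_le_mul_of_nonneg_left (hball x hx) hC0)) h0 hu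
    simp only [add_zero, sub_self, map_zero, sub_zero] at this
    exact this.trans (by gcongr; exact hball u hu)
  have hd : ∀ u, HasFDerivAt
      (fun u => f (z + u) - f z - fderiv ℝ f z u - (1 / 2) * fderiv ℝ (fderiv ℝ f) z u u)
      (fderiv ℝ f (z + u) - fderiv ℝ f z - fderiv ℝ (fderiv ℝ f) z u) u := fun u => by
    have hd1 := ((hf.differentiable (by norm_num)) (z + u)).hasFDerivAt.comp u (hz u)
    have hd2 := ((fderiv ℝ (fderiv ℝ f) z).hasFDerivAt (x := u)).clm_apply (hasFDerivAt_id u)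
    refine (((hd1.sub_const (f z)).sub (fderiv ℝ f z).hasFDerivAt).sub
      (hd2.const_mul (1 / 2 : ℝ))).congr_fderiv ?_
    ext w
    have := hsymm.eq u w
    simp [this]
    ring
  have := hconv.norm_image_sub_le_of_norm_hasFDerivWithin_le
    (fun x _ => (hd x).hasFDerivWithinAt) h1 h0 (by simp : v ∈ Metric.closedBall (0 : E) ‖v‖)
  simp only [add_zero, sub_self, map_zero, sub_zero, mul_zero, Real.norm_eq_abs] at this
  exact this.trans (by ring_nf; exact le_rfl)

theorem exists_integral_pow_four_gaussianReal_le :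
    ∃ K : ℝ, 0 ≤ K ∧ ∀ (a : ℝ) (v : ℝ≥0),
      ∫ x, x ^ 4 ∂(gaussianReal a v) ≤ K * (a ^ 4 + (v : ℝ) ^ 2) := by
  have hx4 : Integrable (fun x : ℝ => x ^ 4) (gaussianReal 0 1) := by
    have := (memLp_id_gaussianReal (μ := 0) (v := 1) 4).integrable_norm_pow'
    simpa [Even.pow_abs (by decide : Even 4)] using this
  set I := ∫ x, x ^ 4 ∂(gaussianReal 0 1) with hI
  have hI0 : 0 ≤ I := integral_nonneg fun x => by positivity
  refine ⟨8 + 8 * I, by positivity, fun a v => ?_⟩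
  have hmap : gaussianReal a v = (gaussianReal 0 1).map (fun x => a + √(v : ℝ) * x) := by
    have h1 := gaussianReal_map_const_mul (μ := 0) (v := 1) √(v : ℝ)
    have h2 := gaussianReal_map_const_add (μ := 0) (v := v) a
    have h3 : NNReal.mk (√(v : ℝ) ^ 2) (sq_nonneg _) * 1 = v := by
      ext; simp
    rw [h3, mul_zero] at h1
    rw [zero_add, ← h1, Measure.map_map (by fun_prop) (by fun_prop)] at h2
    exact h2.symm
  rw [hmap, integral_map (by fun_prop) (by fun_prop)]
  have hle : ∀ x : ℝ, (a + √(v : ℝ) * x) ^ 4 ≤ 8 * a ^ 4 + 8 * (v : ℝ) ^ 2 * x ^ 4 := fun x => by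
    have h4 : (√(v : ℝ) * x) ^ 4 = (v : ℝ) ^ 2 * x ^ 4 := by
      rw [mul_pow, show (√(v : ℝ)) ^ 4 = (√(v : ℝ) ^ 2) ^ 2 by ring, Real.sq_sqrt v.coe_nonneg]
    rw [mul_assoc, ← h4]
    generalize √(v : ℝ) * x = y
    nlinarith [sq_nonneg (a - y), sq_nonneg (a ^ 2 - y ^ 2), sq_nonneg (a + y),
      mul_nonneg (sq_nonneg (a - y)) (sq_nonneg (a - y)),
      mul_nonneg (sq_nonneg (a - y)) (sq_nonneg (a + y)), sq_nonneg ((a - y) ^ 2)]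
  have hbound4 : Integrable (fun x => 8 * a ^ 4 + 8 * (v : ℝ) ^ 2 * x ^ 4) (gaussianReal 0 1) :=
    (integrable_const _).add (hx4.const_mul _)
  calc _ ≤ ∫ x, (8 * a ^ 4 + 8 * (v : ℝ) ^ 2 * x ^ 4) ∂(gaussianReal 0 1) :=
        integral_mono_of_nonneg (ae_of_all _ fun x => by positivity) hbound4 (ae_of_all _ hle)
    _ = 8 * a ^ 4 + 8 * (v : ℝ) ^ 2 * I := by
        rw [integral_add (integrable_const _) (hx4.const_mul _)]
        simp [integral_const_mul, hI]
    _ ≤ _ := by nlinarith [mul_nonneg hI0 (by positivity : 0 ≤ a ^ 4), sq_nonneg (v : ℝ)]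

section GaussianMoments

variable {H : Type*} [NormedAddCommGroup H] [InnerProductSpace ℝ H]
  [SecondCountableTopology H] [MeasurableSpace H] [BorelSpace H]

theorem memLp_inner_sub_of_isGaussian (ν : Measure H) [IsGaussian ν] (x w : H) (p : ℝ≥0) :
    MemLp (fun y => ⟪y - x, w⟫_ℝ) p ν := by
  have h1 := (IsGaussian.memLp_dual ν (innerSL ℝ w) p (by simp)).sub (memLp_const ⟪w, x⟫_ℝ)
  refine h1.congr_norm (by fun_prop) (ae_of_all _ fun y => ?_)
  simp [inner_sub_left, real_inner_comm]

variable [CompleteSpace H]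

theorem integral_inner_sub_of_isGaussian (ν : Measure H) [IsGaussian ν] (x w : H) :
    ∫ y, ⟪y - x, w⟫_ℝ ∂ν = ⟪(∫ y, y ∂ν) - x, w⟫_ℝ := by
  have h1 : Integrable (fun y : H => y - x) ν :=
    (IsGaussian.integrable_id (μ := ν)).sub (integrable_const x)
  have h2 := (innerSL ℝ w).integral_comp_comm h1
  have h3 : ∫ y, (y - x) ∂ν = (∫ y, y ∂ν) - x := by
    have := integral_sub (IsGaussian.integrable_id (μ := ν)) (integrable_const x)
    simpa using this
  rw [h3] at h2
  simpa [real_inner_comm] using h2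

theorem integral_inner_sub_mul_of_isGaussian (ν : Measure H) [IsGaussian ν] (x u v : H) :
    ∫ y, ⟪y - x, u⟫_ℝ * ⟪y - x, v⟫_ℝ ∂ν =
      (∫ y, ⟪y - ∫ y, y ∂ν, u⟫_ℝ * ⟪y - ∫ y, y ∂ν, v⟫_ℝ ∂ν) +
        ⟪(∫ y, y ∂ν) - x, u⟫_ℝ * ⟪(∫ y, y ∂ν) - x, v⟫_ℝ := by
  set m := ∫ y, y ∂ν with hm
  have hL (w : H) : MemLp (fun y => ⟪y - m, w⟫_ℝ) 2 ν :=
    memLp_inner_sub_of_isGaussian ν m w 2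
  have hI (w : H) : Integrable (fun y => ⟪y - m, w⟫_ℝ) ν :=
    (hL w).integrable (by norm_num)
  have h0 (w : H) : ∫ y, ⟪y - m, w⟫_ℝ ∂ν = 0 := by
    rw [integral_inner_sub_of_isGaussian, ← hm, sub_self, inner_zero_left]
  have hsplit : ∀ y, ⟪y - x, u⟫_ℝ * ⟪y - x, v⟫_ℝ =
      ⟪y - m, u⟫_ℝ * ⟪y - m, v⟫_ℝ + (⟪m - x, v⟫_ℝ * ⟪y - m, u⟫_ℝ +
        (⟪m - x, u⟫_ℝ * ⟪y - m, v⟫_ℝ + ⟪m - x, u⟫_ℝ * ⟪m - x, v⟫_ℝ)) := fun y => by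
    have (w : H) : ⟪y - x, w⟫_ℝ = ⟪y - m, w⟫_ℝ + ⟪m - x, w⟫_ℝ := by
      rw [← inner_add_left, sub_add_sub_cancel]
    rw [this, this]; ring
  have hI2 := (hI v).const_mul ⟪m - x, u⟫_ℝ
  have hI3 := hI2.add (integrable_const (μ := ν) (⟪m - x, u⟫_ℝ * ⟪m - x, v⟫_ℝ))
  have hI1 := (hI u).const_mul ⟪m - x, v⟫_ℝ
  have e1 := integral_add ((hL u).integrable_mul (hL v)) (hI1.add hI3)
  have e2 := integral_add hI1 hI3
  have e3 := integral_add hI2 (integrable_const (μ := ν) (⟪m - x, u⟫_ℝ * ⟪m - x, v⟫_ℝ))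
  simp only [Pi.add_apply, Pi.mul_apply] at e1 e2 e3
  rw [integral_congr_ae (ae_of_all _ hsplit), e1, e2, e3, integral_const_mul, integral_const_mul, h0, h0]
  simp

theorem exists_integral_inner_sub_pow_four_le :
    ∃ K : ℝ, 0 ≤ K ∧ ∀ (ν : Measure H) [IsGaussian ν] (x w : H),
      ∫ y, ⟪y - x, w⟫_ℝ ^ 4 ∂ν ≤ K * (⟪(∫ y, y ∂ν) - x, w⟫_ℝ ^ 4 +
        (∫ y, ⟪y - ∫ y, y ∂ν, w⟫_ℝ * ⟪y - ∫ y, y ∂ν, w⟫_ℝ ∂ν) ^ 2) := by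
  obtain ⟨K, hK0, hK⟩ := exists_integral_pow_four_gaussianReal_le
  refine ⟨K, hK0, fun ν _ x w => ?_⟩
  have hlaw := IsGaussian.map_eq_gaussianReal (μ := ν) (innerSL ℝ w)
  have hmap : ν.map (fun y => ⟪y - x, w⟫_ℝ) =
      gaussianReal (ν[innerSL ℝ w] - ⟪w, x⟫_ℝ) Var[innerSL ℝ w; ν].toNNReal := by
    rw [← gaussianReal_map_sub_const, ← hlaw, Measure.map_map (by fun_prop) (by fun_prop)]
    congr 1
    ext y
    simp [inner_sub_left, real_inner_comm]
  have hmean : ν[innerSL ℝ w] = ⟪∫ y, y ∂ν, w⟫_ℝ := by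
    rw [IsGaussian.integral_dual, innerSL_apply_apply, real_inner_comm]
  have hvar : Var[innerSL ℝ w; ν] =
      ∫ y, ⟪y - ∫ y, y ∂ν, w⟫_ℝ * ⟪y - ∫ y, y ∂ν, w⟫_ℝ ∂ν := by
    rw [variance_eq_integral (by fun_prop), hmean]
    congr 1
    ext y
    rw [innerSL_apply_apply, real_inner_comm, inner_sub_left, sq]
  have := hK (ν[innerSL ℝ w] - ⟪w, x⟫_ℝ) Var[innerSL ℝ w; ν].toNNReal
  rw [← hmap, integral_map (by fun_prop) (by fun_prop),
    Real.coe_toNNReal _ (variance_nonneg _ _), hvar, hmean,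
    real_inner_comm x w, ← inner_sub_left] at this
  exact this

/-- Small-time expansion of the integral of a function which admits a second order expansion in
finitely many linear functionals, against Gaussian measures concentrating at a point. -/
theorem tendsto_integral_gaussian_of_expansion {κ : Type*} [Fintype κ] (ν : ℝ → Measure H)
    (hν : ∀ t > 0, IsGaussian (ν t)) (x : H) (b : κ → H) (α : κ → ℝ) (γ : κ → κ → ℝ)
    (hα : ∀ k, Tendsto (fun t => ⟪(∫ y, y ∂(ν t)) - x, b k⟫_ℝ / t) (nhdsWithin 0 (Ioi 0))
      (nhds (α k)))
    (hγ : ∀ k l, Tendsto (fun t => (∫ y, ⟪y - ∫ y, y ∂(ν t), b k⟫_ℝ *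
      ⟪y - ∫ y, y ∂(ν t), b l⟫_ℝ ∂(ν t)) / t) (nhdsWithin 0 (Ioi 0)) (nhds (γ k l)))
    (Φ : H → ℝ) (hΦ : Continuous Φ) {M : ℝ} (hM : ∀ y, |Φ y| ≤ M) (p : κ → ℝ) (s : κ → κ → ℝ)
    {C : ℝ} (hC : ∀ y, |Φ y - Φ x - ∑ k, p k * ⟪y - x, b k⟫_ℝ -
      (1 / 2) * ∑ k, ∑ l, s k l * (⟪y - x, b k⟫_ℝ * ⟪y - x, b l⟫_ℝ)| ≤
        C * ∑ k, |⟪y - x, b k⟫_ℝ| ^ 3) (hC0 : 0 ≤ C) :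
    Tendsto (fun t => (1 / t) * ((∫ y, Φ y ∂(ν t)) - Φ x)) (nhdsWithin 0 (Ioi 0))
      (nhds ((1 / 2) * ∑ k, ∑ l, s k l * γ k l + ∑ k, p k * α k)) := by
  obtain ⟨K, hK0, hK⟩ := exists_integral_inner_sub_pow_four_le (H := H)
  have ht0 : Tendsto (fun t : ℝ => t) (nhdsWithin 0 (Ioi 0)) (nhds 0) :=
    tendsto_nhdsWithin_of_tendsto_nhds tendsto_id
  have hsqrt : Tendsto (fun t : ℝ => √t) (nhdsWithin 0 (Ioi 0)) (nhds 0) := by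
    simpa [Function.comp_def] using (Real.continuous_sqrt.tendsto 0).comp ht0
  have hpos : ∀ᶠ t : ℝ in nhdsWithin 0 (Ioi 0), 0 < t := self_mem_nhdsWithin
  set a : κ → ℝ → ℝ := fun k t => ⟪(∫ y, y ∂(ν t)) - x, b k⟫_ℝ with ha
  set c : κ → κ → ℝ → ℝ := fun k l t => ∫ y, ⟪y - ∫ y, y ∂(ν t), b k⟫_ℝ *
      ⟪y - ∫ y, y ∂(ν t), b l⟫_ℝ ∂(ν t) with hc
  have hcross : ∀ k l, Tendsto (fun t => (c k l t + a k t * a l t) / t)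
      (nhdsWithin 0 (Ioi 0)) (nhds (γ k l)) := fun k l => by
    have h1 := (hγ k l).add (((hα k).mul (hα l)).mul ht0)
    rw [mul_zero, add_zero] at h1
    refine h1.congr' ?_
    filter_upwards [hpos] with t ht
    simp only [ha, hc]
    field_simp
  have hmain : Tendsto (fun t => (1 / 2) * ∑ k, ∑ l, s k l * ((c k l t + a k t * a l t) / t) +
      ∑ k, p k * (a k t / t)) (nhdsWithin 0 (Ioi 0))
      (nhds ((1 / 2) * ∑ k, ∑ l, s k l * γ k l + ∑ k, p k * α k)) :=
    ((tendsto_finsetSum _ fun k _ => tendsto_finsetSum _ fun l _ =>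
      (hcross k l).const_mul (s k l)).const_mul _).add
      (tendsto_finsetSum _ fun k _ => (hα k).const_mul (p k))
  have hbound : Tendsto (fun t => C * ∑ k, (√t * ((c k k t + a k t * a k t) / t) +
      √t * (K * (t ^ 2 * (a k t / t) ^ 4 + (c k k t / t) ^ 2)))) (nhdsWithin 0 (Ioi 0))
      (nhds 0) := by
    have : Tendsto (fun t => C * ∑ k, (√t * ((c k k t + a k t * a k t) / t) +
      √t * (K * (t ^ 2 * (a k t / t) ^ 4 + (c k k t / t) ^ 2)))) (nhdsWithin 0 (Ioi 0))
      (nhds (C * ∑ k, (0 * γ k k + 0 * (K * (0 ^ 2 * α k ^ 4 + γ k k ^ 2))))) :=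
      (tendsto_finsetSum _ fun k _ => (hsqrt.mul (hcross k k)).add
        (hsqrt.mul ((((ht0.pow 2).mul ((hα k).pow 4)).add ((hγ k k).pow 2)).const_mul
          K))).const_mul C
    simpa using this
  refine hmain.congr_dist (squeeze_zero' (Eventually.of_forall fun _ => dist_nonneg) ?_ hbound)
  filter_upwards [hpos] with t ht
  have := hν t ht
  have hst : 0 < √t := Real.sqrt_pos.2 ht
  have hL (k : κ) (q : ℝ≥0) : MemLp (fun y => ⟪y - x, b k⟫_ℝ) q (ν t) :=
    memLp_inner_sub_of_isGaussian (ν t) x (b k) q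
  have hI1 (k : κ) : Integrable (fun y => ⟪y - x, b k⟫_ℝ) (ν t) := (hL k 1).integrable (by simp)
  have hI2 (k l : κ) : Integrable (fun y => ⟪y - x, b k⟫_ℝ * ⟪y - x, b l⟫_ℝ) (ν t) :=
    MemLp.integrable_mul (p := 2) (q := 2) (hL k 2) (hL l 2)
  have hI4 (k : κ) : Integrable (fun y => ⟪y - x, b k⟫_ℝ ^ 4) (ν t) := by
    have := (hL k 4).integrable_norm_pow'
    simpa [Even.pow_abs (by decide : Even 4)] using this
  have hIΦ : Integrable Φ (ν t) :=
    (integrable_const M).mono' hΦ.aestronglyMeasurable (ae_of_all _ hM)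
  have hIp : Integrable (fun y => ∑ k, p k * ⟪y - x, b k⟫_ℝ) (ν t) :=
    integrable_finsetSum _ fun k _ => (hI1 k).const_mul _
  have hIs : Integrable (fun y => (1 / 2) * ∑ k, ∑ l, s k l * (⟪y - x, b k⟫_ℝ * ⟪y - x, b l⟫_ℝ))
      (ν t) :=
    (integrable_finsetSum _ fun k _ => integrable_finsetSum _ fun l _ =>
      (hI2 k l).const_mul _).const_mul _
  have hR : ∫ y, (Φ y - Φ x - ∑ k, p k * ⟪y - x, b k⟫_ℝ -
      (1 / 2) * ∑ k, ∑ l, s k l * (⟪y - x, b k⟫_ℝ * ⟪y - x, b l⟫_ℝ)) ∂(ν t) =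
      (∫ y, Φ y ∂(ν t)) - Φ x - ∑ k, p k * a k t -
        (1 / 2) * ∑ k, ∑ l, s k l * (c k l t + a k t * a l t) := by
    have hIc := hIΦ.sub (integrable_const (μ := ν t) (Φ x))
    have e1 := integral_sub (hIc.sub hIp) hIs
    have e2 := integral_sub hIc hIp
    have e3 := integral_sub hIΦ (integrable_const (μ := ν t) (Φ x))
    simp only [Pi.sub_apply] at e1 e2 e3
    rw [e1, e2, e3,
      integral_finsetSum _ fun k _ => (hI1 k).const_mul _, integral_const_mul,
      integral_finsetSum _ fun k _ => integrable_finsetSum _ fun l _ => (hI2 k l).const_mul _]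
    congr 1
    · simp [integral_const_mul, integral_inner_sub_of_isGaussian, ha]
    · congr 1
      refine Finset.sum_congr rfl fun k _ => ?_
      rw [integral_finsetSum _ fun l _ => (hI2 k l).const_mul _]
      refine Finset.sum_congr rfl fun l _ => ?_
      rw [integral_const_mul, integral_inner_sub_mul_of_isGaussian]
  have hcube : ∀ r : ℝ, |r| ^ 3 ≤ √t * (r * r) + (√t)⁻¹ * r ^ 4 := fun r => by
    have h1 : 0 ≤ (√t)⁻¹ * r ^ 2 * (√t - |r|) ^ 2 := by positivity
    have h2 : (√t)⁻¹ * r ^ 2 * (√t - |r|) ^ 2 =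
        √t * r ^ 2 - 2 * (|r| * r ^ 2) + (√t)⁻¹ * (r ^ 2 * |r| ^ 2) := by field_simp; ring
    have h3 : 0 ≤ |r| * r ^ 2 := by positivity
    rw [h2, sq_abs] at h1
    have h4 : |r| ^ 3 = |r| * r ^ 2 := by rw [← sq_abs r]; ring
    rw [h4]
    nlinarith
  have hest : |∫ y, (Φ y - Φ x - ∑ k, p k * ⟪y - x, b k⟫_ℝ -
      (1 / 2) * ∑ k, ∑ l, s k l * (⟪y - x, b k⟫_ℝ * ⟪y - x, b l⟫_ℝ)) ∂(ν t)| ≤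
      C * ∑ k, (√t * (c k k t + a k t * a k t) + (√t)⁻¹ * (K * (a k t ^ 4 + c k k t ^ 2))) := by
    have hIk (k : κ) : Integrable (fun y => √t * (⟪y - x, b k⟫_ℝ * ⟪y - x, b k⟫_ℝ) +
        (√t)⁻¹ * ⟪y - x, b k⟫_ℝ ^ 4) (ν t) :=
      ((hI2 k k).const_mul _).add ((hI4 k).const_mul _)
    calc _ ≤ ∫ y, C * ∑ k, (√t * (⟪y - x, b k⟫_ℝ * ⟪y - x, b k⟫_ℝ) +
          (√t)⁻¹ * ⟪y - x, b k⟫_ℝ ^ 4) ∂(ν t) := by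
          rw [← Real.norm_eq_abs]
          refine norm_integral_le_of_norm_le
            ((integrable_finsetSum _ fun k _ => hIk k).const_mul C) (ae_of_all _ fun y => ?_)
          exact (hC y).trans (mul_le_mul_of_nonneg_left
            (Finset.sum_le_sum fun k _ => hcube _) hC0)
      _ = C * ∑ k, (√t * (c k k t + a k t * a k t) +
          (√t)⁻¹ * ∫ y, ⟪y - x, b k⟫_ℝ ^ 4 ∂(ν t)) := by
          rw [integral_const_mul, integral_finsetSum _ fun k _ => hIk k]
          congr 1
          refine Finset.sum_congr rfl fun k _ => ?_
          rw [integral_add ((hI2 k k).const_mul _) ((hI4 k).const_mul _), integral_const_mul,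
            integral_const_mul, integral_inner_sub_mul_of_isGaussian]
      _ ≤ _ := by
          refine mul_le_mul_of_nonneg_left (Finset.sum_le_sum fun k _ => ?_) hC0
          gcongr
          exact hK (ν t) x (b k)
  rw [hR] at hest
  rw [Real.dist_eq, abs_sub_comm]
  have hlhs : 1 / t * ((∫ y, Φ y ∂(ν t)) - Φ x) -
      ((1 / 2) * ∑ k, ∑ l, s k l * ((c k l t + a k t * a l t) / t) + ∑ k, p k * (a k t / t)) =
      ((∫ y, Φ y ∂(ν t)) - Φ x - ∑ k, p k * a k t -
        (1 / 2) * ∑ k, ∑ l, s k l * (c k l t + a k t * a l t)) / t := by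
    simp only [← mul_div_assoc, ← Finset.sum_div]
    ring
  rw [hlhs, abs_div, abs_of_pos ht, div_le_iff₀ ht]
  refine hest.trans (le_of_eq ?_)
  rw [mul_assoc, Finset.sum_mul]
  congr 1
  refine Finset.sum_congr rfl fun k _ => ?_
  have hinv : (√t)⁻¹ = √t / t := by
    rw [Real.sqrt_div_self', one_div]
  rw [hinv]
  field_simp

end GaussianMoments
theorem tendsto_intervalIntegral_div_nhdsGT_zero {g : ℝ → ℝ} (hg : ContinuousOn g (Ici 0)) :
    Tendsto (fun t => (∫ s in (0 : ℝ)..t, g s) / t) (nhdsWithin 0 (Ioi 0)) (nhds (g 0)) := by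
  have hmeas : StronglyMeasurableAtFilter g (nhdsWithin 0 (Ioi 0)) :=
    ⟨Ioi 0, self_mem_nhdsWithin,
      (hg.mono Ioi_subset_Ici_self).aestronglyMeasurable measurableSet_Ioi⟩
  have h := intervalIntegral.integral_hasDerivWithinAt_right (a := (0 : ℝ)) (b := 0) (s := Ici 0)
    (t := Ioi 0) (f := g) (by simp) hmeas
    ((hg 0 self_mem_Ici).mono Ioi_subset_Ici_self)
  have h2 := (hasDerivWithinAt_iff_tendsto_slope' self_notMem_Ioi).1
    (h.mono Ioi_subset_Ici_self)
  refine h2.congr fun t => ?_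
  simp [slope_def_field]

theorem eq_sum_inner_smul_of_mem {H : Type*} [NormedAddCommGroup H] [InnerProductSpace ℝ H]
    {W : Submodule ℝ H} {κ : Type*} [Fintype κ] (b : OrthonormalBasis κ ℝ W) {w : H}
    (hw : w ∈ W) : w = ∑ k, ⟪w, b k⟫_ℝ • (b k : H) := by
  have := congrArg Subtype.val (b.sum_repr' ⟨w, hw⟩)
  simp only [Submodule.coe_sum, Submodule.coe_smul, Submodule.coe_inner] at this
  simpa only [real_inner_comm] using this.symm

theorem sub_sum_inner_smul_mem_orthogonal {H : Type*} [NormedAddCommGroup H]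
    [InnerProductSpace ℝ H] {W : Submodule ℝ H} {κ : Type*} [Fintype κ]
    (b : OrthonormalBasis κ ℝ W) (u : H) : u - ∑ k, ⟪u, b k⟫_ℝ • (b k : H) ∈ Wᗮ := by
  rw [Submodule.mem_orthogonal']
  intro w hw
  have h1 : ⟪u, w⟫_ℝ = ∑ k, ⟪w, b k⟫_ℝ * ⟪u, b k⟫_ℝ := by
    conv_lhs => rw [eq_sum_inner_smul_of_mem b hw]
    simp [inner_sum, inner_smul_right]
  rw [inner_sub_left, h1, sum_inner, sub_eq_zero]
  refine Finset.sum_congr rfl fun k _ => ?_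
  rw [real_inner_smul_left, real_inner_comm, mul_comm]

section Semigroup

variable {H : Type*} [NormedAddCommGroup H] [InnerProductSpace ℝ H] [CompleteSpace H]
  {L : ℝ → H →L[ℝ] H}

theorem hasDerivWithinAt_adjoint_sum_smul {κ : Type*} [Fintype κ] (c : κ → ℝ) {u Au : κ → H}
    (h : ∀ k, HasDerivWithinAt (fun s => ContinuousLinearMap.adjoint (L s) (u k)) (Au k)
      (Ici 0) 0) :
    HasDerivWithinAt (fun s => ContinuousLinearMap.adjoint (L s) (∑ k, c k • u k))
      (∑ k, c k • Au k) (Ici 0) 0 := by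
  simp only [map_sum, map_smul]
  exact HasDerivWithinAt.fun_sum fun k _ => (h k).const_smul (c k)

theorem hasDerivWithinAt_inner_semigroup
    (hLsem : ∀ s ≥ (0 : ℝ), ∀ t ≥ (0 : ℝ), L (s + t) = (L s).comp (L t)) {w Aw : H}
    (hw : HasDerivWithinAt (fun s => ContinuousLinearMap.adjoint (L s) w) Aw (Ici 0) 0)
    {s : ℝ} (hs : 0 ≤ s) (x : H) :
    HasDerivWithinAt (fun r => ⟪L r x, w⟫_ℝ) ⟪L s x, Aw⟫_ℝ (Ici s) s := by
  have hsub : HasDerivWithinAt (fun r => r - s) 1 (Ici s) s :=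
    (hasDerivWithinAt_id s (Ici s)).sub_const s
  have h1 : HasDerivWithinAt (fun r => ContinuousLinearMap.adjoint (L (r - s)) w) Aw (Ici s) s := by
    have := HasDerivWithinAt.scomp (t' := Ici 0) s (by simpa using hw) hsub
      (fun r hr => by simpa using hr)
    simpa [Function.comp_def] using this
  have h2 := (innerSL ℝ (L s x)).hasFDerivAt.comp_hasDerivWithinAt s h1
  have h3 : ∀ r ∈ Ici s, ⟪L r x, w⟫_ℝ = ⟪L s x, ContinuousLinearMap.adjoint (L (r - s)) w⟫_ℝ :=
    fun r hr => by
      have : L r = (L (r - s)).comp (L s) := by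
        rw [← hLsem _ (sub_nonneg.2 hr) _ hs, sub_add_cancel]
      rw [ContinuousLinearMap.adjoint_inner_right, this, ContinuousLinearMap.comp_apply]
  exact h2.congr h3 (h3 s self_mem_Ici)

theorem inner_semigroup_eq_zero_of_invariant (hL0 : L 0 = ContinuousLinearMap.id ℝ H)
    (hLsem : ∀ s ≥ (0 : ℝ), ∀ t ≥ (0 : ℝ), L (s + t) = (L s).comp (L t))
    (hLcont : ∀ x : H, ContinuousOn (fun t => L t x) (Ici 0))
    {κ : Type*} [Fintype κ] (b : κ → H) (a : Matrix κ κ ℝ)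
    (hb : ∀ k, HasDerivWithinAt (fun s => ContinuousLinearMap.adjoint (L s) (b k))
      (∑ l, a k l • b l) (Ici 0) 0)
    {x : H} (hx : ∀ k, ⟪x, b k⟫_ℝ = 0) {s : ℝ} (hs : 0 ≤ s) (k : κ) : ⟪L s x, b k⟫_ℝ = 0 := by
  classical
  set F : ℝ → κ → ℝ := fun r k => ⟪L r x, b k⟫_ℝ with hF
  set M : (κ → ℝ) →L[ℝ] (κ → ℝ) := LinearMap.toContinuousLinearMap (Matrix.mulVecLin a) with hM
  have hcont : ContinuousOn F (Icc 0 s) := continuousOn_pi.2 fun k =>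
    ((hLcont x).mono Icc_subset_Ici_self).inner continuousOn_const
  have hder : ∀ r ∈ Ico 0 s, HasDerivWithinAt F (M (F r)) (Ici r) r := fun r hr => by
    refine hasDerivWithinAt_pi.2 fun k => ?_
    have := hasDerivWithinAt_inner_semigroup hLsem (hb k) hr.1 x
    refine this.congr_deriv ?_
    simp [hM, hF, Matrix.mulVec, dotProduct, inner_sum, inner_smul_right]
  have := eq_zero_of_abs_deriv_le_mul_abs_self_of_eq_zero_right hcont hder
    (by ext k; simp [hF, hL0, hx]) (fun r _ => M.le_opNorm (F r)) s ⟨hs, le_rfl⟩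
  exact congrFun this k

theorem adjoint_semigroup_mem_of_invariant (hL0 : L 0 = ContinuousLinearMap.id ℝ H)
    (hLsem : ∀ s ≥ (0 : ℝ), ∀ t ≥ (0 : ℝ), L (s + t) = (L s).comp (L t))
    (hLcont : ∀ x : H, ContinuousOn (fun t => L t x) (Ici 0))
    {W : Submodule ℝ H} [FiniteDimensional ℝ W]
    (hW : ∀ w ∈ W, ∃ Aw ∈ W,
      HasDerivWithinAt (fun s => ContinuousLinearMap.adjoint (L s) w) Aw (Ici 0) 0)
    {w : H} (hw : w ∈ W) {s : ℝ} (hs : 0 ≤ s) : ContinuousLinearMap.adjoint (L s) w ∈ W := by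
  set b := stdOrthonormalBasis ℝ W
  choose Ab hAbW hAb using fun k => hW (b k) (b k).2
  rw [← Submodule.orthogonal_orthogonal W, Submodule.mem_orthogonal]
  intro x hx
  rw [ContinuousLinearMap.adjoint_inner_right, eq_sum_inner_smul_of_mem b hw, inner_sum]
  refine Finset.sum_eq_zero fun k _ => ?_
  rw [inner_smul_right, inner_semigroup_eq_zero_of_invariant hL0 hLsem hLcont
    (fun k => (b k : H)) (fun k l => ⟪Ab k, b l⟫_ℝ)
    (fun k => by rw [← eq_sum_inner_smul_of_mem b (hAbW k)]; exact hAb k)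
    (fun k => (Submodule.mem_orthogonal' _ _).1 hx _ (b k).2) hs, mul_zero]

theorem continuousOn_bilin_adjoint_semigroup (hL0 : L 0 = ContinuousLinearMap.id ℝ H)
    (hLsem : ∀ s ≥ (0 : ℝ), ∀ t ≥ (0 : ℝ), L (s + t) = (L s).comp (L t))
    (hLcont : ∀ x : H, ContinuousOn (fun t => L t x) (Ici 0))
    {W : Submodule ℝ H} [FiniteDimensional ℝ W]
    (hW : ∀ w ∈ W, ∃ Aw ∈ W,
      HasDerivWithinAt (fun s => ContinuousLinearMap.adjoint (L s) w) Aw (Ici 0) 0)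
    (β : H →ₗ[ℝ] H →ₗ[ℝ] ℝ) {w : H} (hw : w ∈ W) :
    ContinuousOn (fun s => β (ContinuousLinearMap.adjoint (L s) w)
      (ContinuousLinearMap.adjoint (L s) w)) (Ici 0) := by
  set b := stdOrthonormalBasis ℝ W
  have hexp : ∀ s ∈ Ici (0 : ℝ), β (ContinuousLinearMap.adjoint (L s) w)
      (ContinuousLinearMap.adjoint (L s) w) =
      ∑ k, ∑ l, ⟪w, L s (b k)⟫_ℝ * (⟪w, L s (b l)⟫_ℝ * β (b k) (b l)) := fun s hs => by
    have := eq_sum_inner_smul_of_mem b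
      (adjoint_semigroup_mem_of_invariant hL0 hLsem hLcont hW hw hs)
    simp only [ContinuousLinearMap.adjoint_inner_left] at this
    rw [this]
    simp only [map_sum, map_smul, LinearMap.sum_apply, LinearMap.smul_apply, smul_eq_mul,
      Finset.mul_sum]
    rw [Finset.sum_comm]
    exact Finset.sum_congr rfl fun k _ => Finset.sum_congr rfl fun l _ => mul_left_comm _ _ _
  refine ContinuousOn.congr ?_ hexp
  refine continuousOn_finsetSum _ fun k _ => continuousOn_finsetSum _ fun l _ => ?_
  exact (continuousOn_const.inner (hLcont _)).mul
    ((continuousOn_const.inner (hLcont _)).mul continuousOn_const)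

theorem tendsto_intervalIntegral_bilin_div (hL0 : L 0 = ContinuousLinearMap.id ℝ H)
    (hLsem : ∀ s ≥ (0 : ℝ), ∀ t ≥ (0 : ℝ), L (s + t) = (L s).comp (L t))
    (hLcont : ∀ x : H, ContinuousOn (fun t => L t x) (Ici 0))
    {W : Submodule ℝ H} [FiniteDimensional ℝ W]
    (hW : ∀ w ∈ W, ∃ Aw ∈ W,
      HasDerivWithinAt (fun s => ContinuousLinearMap.adjoint (L s) w) Aw (Ici 0) 0)
    (β : H →ₗ[ℝ] H →ₗ[ℝ] ℝ) {w : H} (hw : w ∈ W) :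
    Tendsto (fun t => (∫ s in (0 : ℝ)..t, β (ContinuousLinearMap.adjoint (L s) w)
      (ContinuousLinearMap.adjoint (L s) w)) / t) (nhdsWithin 0 (Ioi 0)) (nhds (β w w)) := by
  have h0 : ContinuousLinearMap.adjoint (L 0) w = w := by
    rw [hL0]
    exact ext_inner_left ℝ fun v => by simp [ContinuousLinearMap.adjoint_inner_right]
  simpa only [h0] using tendsto_intervalIntegral_div_nhdsGT_zero
    (continuousOn_bilin_adjoint_semigroup hL0 hLsem hLcont hW β hw)

theorem tendsto_mean_increment_div (hL0 : L 0 = ContinuousLinearMap.id ℝ H)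
    (hLsem : ∀ s ≥ (0 : ℝ), ∀ t ≥ (0 : ℝ), L (s + t) = (L s).comp (L t))
    (hLcont : ∀ x : H, ContinuousOn (fun t => L t x) (Ici 0)) {w Aw : H}
    (hw : HasDerivWithinAt (fun s => ContinuousLinearMap.adjoint (L s) w) Aw (Ici 0) 0)
    (lam : ℝ) (c x : H) :
    Tendsto (fun t => (⟪L t x, w⟫_ℝ +
      (∫ s in (0 : ℝ)..t, (lam * ⟪L s c, w⟫_ℝ - ⟪L s c, Aw⟫_ℝ)) - ⟪x, w⟫_ℝ) / t)
      (nhdsWithin 0 (Ioi 0)) (nhds (⟪x, Aw⟫_ℝ + lam * ⟪c, w⟫_ℝ - ⟪c, Aw⟫_ℝ)) := by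
  have h1 := (hasDerivWithinAt_iff_tendsto_slope' self_notMem_Ioi).1
    ((hasDerivWithinAt_inner_semigroup hLsem hw le_rfl x).mono Ioi_subset_Ici_self)
  have h2 := tendsto_intervalIntegral_div_nhdsGT_zero
    (g := fun s => lam * ⟪L s c, w⟫_ℝ - ⟪L s c, Aw⟫_ℝ)
    ((continuousOn_const.mul ((hLcont c).inner continuousOn_const)).sub
      ((hLcont c).inner continuousOn_const))
  have h3 := h1.add h2
  simp only [hL0, ContinuousLinearMap.id_apply, ← add_sub_assoc] at h3
  refine h3.congr fun t => ?_
  rw [slope_def_field, sub_zero, hL0, ContinuousLinearMap.id_apply]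
  ring

end Semigroup

section Bilinear

/-- A function which is symmetric and additive and homogeneous in its first argument on a subspace
agrees there with a bilinear form defined on the whole space. -/
theorem exists_bilin_eqOn_submodule {H : Type*} [AddCommGroup H] [Module ℝ H]
    (D : Submodule ℝ H) (B : H → H → ℝ) (hsym : ∀ u ∈ D, ∀ v ∈ D, B u v = B v u)
    (hadd : ∀ u ∈ D, ∀ v ∈ D, ∀ w ∈ D, B (u + v) w = B u w + B v w)
    (hsmul : ∀ c : ℝ, ∀ u ∈ D, ∀ v ∈ D, B (c • u) v = c * B u v) :
    ∃ β : H →ₗ[ℝ] H →ₗ[ℝ] ℝ, ∀ u ∈ D, ∀ v ∈ D, β u v = B u v := by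
  obtain ⟨π, hπ⟩ := D.subtype.exists_leftInverse_of_injective D.ker_subtype
  set βD : D →ₗ[ℝ] D →ₗ[ℝ] ℝ := LinearMap.mk₂ ℝ (fun u v => B u v)
    (fun u v w => hadd u u.2 v v.2 w w.2) (fun c u v => hsmul c u u.2 v v.2)
    (fun u v w => by
      rw [hsym u u.2 _ (v + w).2, hsym u u.2 v v.2, hsym u u.2 w w.2]
      exact hadd v v.2 w w.2 u u.2)
    (fun c u v => by
      rw [hsym u u.2 _ (c • v).2, hsym u u.2 v v.2]
      exact hsmul c v v.2 u u.2) with hβD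
  refine ⟨βD.compl₁₂ π π, fun u hu v hv => ?_⟩
  have h (w : H) (hw : w ∈ D) : π w = ⟨w, hw⟩ := LinearMap.congr_fun hπ ⟨w, hw⟩
  simp [h u hu, h v hv, hβD]

theorem sum_bilin_eq_sum_orthonormalBasis {H : Type*} [NormedAddCommGroup H]
    [InnerProductSpace ℝ H] {V : Submodule ℝ H} {ι κ : Type*} [Fintype ι] [Fintype κ]
    (c : OrthonormalBasis ι ℝ V) (β : H →ₗ[ℝ] H →ₗ[ℝ] ℝ) (p q : κ → H) (hp : ∀ i, p i ∈ V) :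
    ∑ i, β (p i) (q i) = ∑ k, β (c k) (∑ i, ⟪(c k : H), p i⟫_ℝ • q i) := by
  simp only [map_sum, map_smul]
  rw [Finset.sum_comm]
  refine Finset.sum_congr rfl fun i _ => ?_
  conv_lhs => rw [eq_sum_inner_smul_of_mem c (hp i)]
  simp [LinearMap.sum_apply, real_inner_comm]

/-- A finite sum of values of a bilinear form depends only on the finite-rank operator defined by
the underlying tensor. -/
theorem sum_bilin_eq_of_sum_inner_smul_eq {H : Type*} [NormedAddCommGroup H]
    [InnerProductSpace ℝ H] {κ κ' : Type*} [Fintype κ] [Fintype κ'] (β : H →ₗ[ℝ] H →ₗ[ℝ] ℝ)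
    (p q : κ → H) (p' q' : κ' → H)
    (h : ∀ u, ∑ i, ⟪u, p i⟫_ℝ • q i = ∑ i, ⟪u, p' i⟫_ℝ • q' i) :
    ∑ i, β (p i) (q i) = ∑ i, β (p' i) (q' i) := by
  set V : Submodule ℝ H := Submodule.span ℝ (range p ∪ range p') with hV
  have : FiniteDimensional ℝ V :=
    FiniteDimensional.span_of_finite ℝ ((finite_range p).union (finite_range p'))
  rw [sum_bilin_eq_sum_orthonormalBasis (stdOrthonormalBasis ℝ V) β p q
      fun i => Submodule.subset_span (Or.inl ⟨i, rfl⟩),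
    sum_bilin_eq_sum_orthonormalBasis (stdOrthonormalBasis ℝ V) β p' q'
      fun i => Submodule.subset_span (Or.inr ⟨i, rfl⟩)]
  simp_rw [h]

end Bilinear

section Cylindrical

variable {H : Type*} [NormedAddCommGroup H] [InnerProductSpace ℝ H] {n : ℕ}

/-- The coordinate map `x ↦ (⟨x, h₁⟩, …, ⟨x, h_n⟩)`. -/
noncomputable def innerCoords (h : Fin n → H) : H →L[ℝ] (Fin n → ℝ) :=
  ContinuousLinearMap.pi fun i => innerSL ℝ (h i)

theorem innerCoords_apply (h : Fin n → H) (x : H) :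
    innerCoords h x = fun j => ⟪x, h j⟫_ℝ := by
  ext j
  simp [innerCoords, real_inner_comm]

/-- The gradient at `x` of the cylindrical function `f ∘ innerCoords h`. -/
noncomputable def cylGradient (f : (Fin n → ℝ) → ℝ) (h : Fin n → H) (x : H) : H :=
  ∑ i, fderiv ℝ f (innerCoords h x) (Pi.single i 1) • h i

theorem apply_innerCoords (ℓ : (Fin n → ℝ) →L[ℝ] ℝ) (h : Fin n → H) (u : H) :
    ℓ (innerCoords h u) = ⟪∑ i, ℓ (Pi.single i 1) • h i, u⟫_ℝ := by
  have hu : innerCoords h u = ∑ i, ⟪u, h i⟫_ℝ • (Pi.single i 1 : Fin n → ℝ) := by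
    rw [innerCoords_apply]
    exact pi_eq_sum_univ' _
  rw [hu]
  simp [sum_inner, inner_smul_left, real_inner_comm, mul_comm]

theorem fderiv_innerCoords_eq_inner (f : (Fin n → ℝ) → ℝ) (h : Fin n → H) (x u : H) :
    fderiv ℝ f (innerCoords h x) (innerCoords h u) = ⟪cylGradient f h x, u⟫_ℝ :=
  apply_innerCoords _ h u

/-- The span of all gradients of a cylindrical function. -/
noncomputable def cylSpan (f : (Fin n → ℝ) → ℝ) (h : Fin n → H) : Submodule ℝ H :=
  Submodule.span ℝ (range (cylGradient f h))

theorem cylSpan_le (f : (Fin n → ℝ) → ℝ) (h : Fin n → H) :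
    cylSpan f h ≤ Submodule.span ℝ (range h) :=
  Submodule.span_le.2 <| range_subset_iff.2 fun _ =>
    Submodule.sum_mem _ fun i _ => Submodule.smul_mem _ _ (Submodule.subset_span ⟨i, rfl⟩)

instance finiteDimensional_cylSpan (f : (Fin n → ℝ) → ℝ) (h : Fin n → H) :
    FiniteDimensional ℝ (cylSpan f h) :=
  have := FiniteDimensional.span_of_finite ℝ (finite_range h)
  Submodule.finiteDimensional_of_le (cylSpan_le f h)

theorem cylGradient_mem_cylSpan (f : (Fin n → ℝ) → ℝ) (h : Fin n → H) (x : H) :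
    cylGradient f h x ∈ cylSpan f h :=
  Submodule.subset_span ⟨x, rfl⟩

theorem inner_cylGradient_eq_zero (f : (Fin n → ℝ) → ℝ) (h : Fin n → H) (x : H) {w : H}
    (hw : w ∈ (cylSpan f h)ᗮ) : ⟪cylGradient f h x, w⟫_ℝ = 0 :=
  (Submodule.mem_orthogonal _ _).1 hw _ (cylGradient_mem_cylSpan f h x)

theorem cyl_add_orthogonal {f : (Fin n → ℝ) → ℝ} (hf : Differentiable ℝ f) (h : Fin n → H)
    (x : H) {w : H} (hw : w ∈ (cylSpan f h)ᗮ) :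
    f (innerCoords h (x + w)) = f (innerCoords h x) := by
  have hd : ∀ r : ℝ, HasDerivAt (fun r : ℝ => f (innerCoords h (x + r • w))) 0 r := fun r => by
    have h1 : HasDerivAt (fun r : ℝ => innerCoords h (x + r • w)) (innerCoords h w) r := by
      have := (((hasDerivAt_id r).smul_const w).const_add x)
      rw [one_smul] at this
      exact (innerCoords h).hasFDerivAt.comp_hasDerivAt r this
    have h2 := (hf (innerCoords h (x + r • w))).hasFDerivAt.comp_hasDerivAt r h1
    rwa [fderiv_innerCoords_eq_inner, inner_cylGradient_eq_zero f h _ hw] at h2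
  have := is_const_of_deriv_eq_zero (fun r => (hd r).differentiableAt) (fun r => (hd r).deriv) 1 0
  simpa using this

theorem cylGradient_add_orthogonal {f : (Fin n → ℝ) → ℝ} (hf : Differentiable ℝ f)
    (h : Fin n → H) (x : H) {w : H} (hw : w ∈ (cylSpan f h)ᗮ) :
    cylGradient f h (x + w) = cylGradient f h x := by
  have hd (x : H) : HasFDerivAt (fun y => f (innerCoords h y))
      ((fderiv ℝ f (innerCoords h x)).comp (innerCoords h)) x :=
    (hf _).hasFDerivAt.comp x (innerCoords h).hasFDerivAt
  have h1 : HasFDerivAt (fun y => f (innerCoords h y))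
      ((fderiv ℝ f (innerCoords h (x + w))).comp (innerCoords h)) x := by
    have := (hd (x + w)).comp x ((hasFDerivAt_id x).add_const w)
    simp only [Function.comp_def, id, cyl_add_orthogonal hf h _ hw] at this
    exact this
  refine ext_inner_right ℝ fun u => ?_
  rw [← fderiv_innerCoords_eq_inner, ← fderiv_innerCoords_eq_inner]
  exact DFunLike.congr_fun (h1.unique (hd x)) u

theorem sndFDeriv_innerCoords_orthogonal {f : (Fin n → ℝ) → ℝ} (hf : ContDiff ℝ 2 f)
    (h : Fin n → H) (x u : H) {w : H} (hw : w ∈ (cylSpan f h)ᗮ) :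
    fderiv ℝ (fderiv ℝ f) (innerCoords h x) (innerCoords h u) (innerCoords h w) = 0 := by
  have hf1 : ContDiff ℝ 1 (fderiv ℝ f) := hf.fderiv_right (by norm_num)
  have h1 : HasFDerivAt (fun y => fderiv ℝ f (innerCoords h y))
      ((fderiv ℝ (fderiv ℝ f) (innerCoords h x)).comp (innerCoords h)) x :=
    (hf1.differentiable (by norm_num) _).hasFDerivAt.comp x (innerCoords h).hasFDerivAt
  have h2 := h1.clm_apply (hasFDerivAt_const (innerCoords h w) x)
  have h3 : (fun y => fderiv ℝ f (innerCoords h y) (innerCoords h w)) = fun _ => 0 := by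
    ext y
    rw [fderiv_innerCoords_eq_inner, inner_cylGradient_eq_zero f h y hw]
  rw [h3] at h2
  have := DFunLike.congr_fun (h2.unique (hasFDerivAt_const (0 : ℝ) x)) u
  simpa using this

/-- The Hessian of a cylindrical function only involves the span of its gradients. -/
theorem sum_bilin_sndFDeriv_eq [CompleteSpace H] {f : (Fin n → ℝ) → ℝ} (hf : ContDiff ℝ 2 f)
    (h : Fin n → H) (x : H) (β : H →ₗ[ℝ] H →ₗ[ℝ] ℝ) {κ : Type*} [Fintype κ]
    (b : OrthonormalBasis κ ℝ (cylSpan f h)) :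
    ∑ i, ∑ j, β (h i) (h j) * fderiv ℝ (fun z => fderiv ℝ f z (Pi.single i 1))
        (innerCoords h x) (Pi.single j 1) =
      ∑ k, ∑ l, fderiv ℝ (fderiv ℝ f) (innerCoords h x) (innerCoords h (b k))
        (innerCoords h (b l)) * β (b k) (b l) := by
  set S := fderiv ℝ (fderiv ℝ f) (innerCoords h x) with hS
  have hf1 : ContDiff ℝ 1 (fderiv ℝ f) := hf.fderiv_right (by norm_num)
  have hsymm : ∀ u v, S u v = S v u :=
    hf.contDiffAt.isSymmSndFDerivAt (by simp)
  have hpart : ∀ i j, fderiv ℝ (fun z => fderiv ℝ f z (Pi.single i 1))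
      (innerCoords h x) (Pi.single j 1) = S (Pi.single j 1) (Pi.single i 1) := fun i j => by
    rw [fderiv_clm_apply (hf1.differentiable (by norm_num) _) (by fun_prop)]
    simp [hS]
  set G : H → H := fun u => ∑ j, S (innerCoords h u) (Pi.single j 1) • h j with hG
  have hGin : ∀ u v, ⟪G u, v⟫_ℝ = S (innerCoords h u) (innerCoords h v) := fun u v =>
    (apply_innerCoords _ h v).symm
  have hGadd : ∀ u v, G (u + v) = G u + G v := fun u v => by
    simp [hG, add_smul, Finset.sum_add_distrib]
  have hGW : ∀ u, G u ∈ cylSpan f h := fun u => by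
    rw [← Submodule.orthogonal_orthogonal (cylSpan f h), Submodule.mem_orthogonal']
    exact fun w hw => by rw [hGin, sndFDeriv_innerCoords_orthogonal hf h x u hw]
  have hGorth : ∀ w ∈ (cylSpan f h)ᗮ, G w = 0 := fun w hw => ext_inner_right ℝ fun v => by
    rw [hGin, hsymm, sndFDeriv_innerCoords_orthogonal hf h x v hw, inner_zero_left]
  have hten : ∀ u, ∑ i, ⟪u, h i⟫_ℝ • ∑ j, S (Pi.single j 1) (Pi.single i 1) • h j =
      ∑ k, ⟪u, b k⟫_ℝ • G (b k) := by
    intro u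
    have h1 : ∑ i, ⟪u, h i⟫_ℝ • ∑ j, S (Pi.single j 1) (Pi.single i 1) • h j = G u := by
      simp only [Finset.smul_sum]
      rw [Finset.sum_comm]
      refine Finset.sum_congr rfl fun j _ => ?_
      rw [hsymm, apply_innerCoords, sum_inner, Finset.sum_smul]
      simp only [inner_smul_left, real_inner_comm, smul_smul, mul_comm]
      rfl
    have h2 : ∑ k, ⟪u, b k⟫_ℝ • G (b k) = G (∑ k, ⟪u, b k⟫_ℝ • (b k : H)) := by
      simp only [hG, map_sum, map_smul, sum_apply,
        smul_apply, Finset.smul_sum, Finset.sum_smul, smul_smul, smul_eq_mul]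
      rw [Finset.sum_comm]
    have h3 : u - ∑ k, ⟪u, b k⟫_ℝ • (b k : H) ∈ (cylSpan f h)ᗮ :=
      sub_sum_inner_smul_mem_orthogonal b u
    rw [h1, h2]
    conv_lhs => rw [← sub_add_cancel u (∑ k, ⟪u, b k⟫_ℝ • (b k : H)), hGadd, hGorth _ h3, zero_add]
  calc _ = ∑ i, β (h i) (∑ j, S (Pi.single j 1) (Pi.single i 1) • h j) := by
        simp only [hpart, map_sum, map_smul, smul_eq_mul, mul_comm]
    _ = ∑ k, β (b k) (G (b k)) := sum_bilin_eq_of_sum_inner_smul_eq β _ _ _ _ hten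
    _ = _ := by
        refine Finset.sum_congr rfl fun k _ => ?_
        conv_lhs => rw [eq_sum_inner_smul_of_mem b (hGW (b k))]
        simp [hGin]

/-- If the drift term of a cylindrical function is bounded, then the span of its gradients is
invariant under the adjoint generator. -/
theorem exists_adjoint_deriv_mem_cylSpan [CompleteSpace H] {L : ℝ → H →L[ℝ] H}
    {f : (Fin n → ℝ) → ℝ} (hf : Differentiable ℝ f) {h Ah : Fin n → H}
    (hdom : ∀ i, HasDerivWithinAt
      (fun s => ContinuousLinearMap.adjoint (L s) (h i)) (Ah i) (Ici 0) 0)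
    {C : ℝ} (hC : ∀ x : H,
      |∑ i, ⟪x, Ah i⟫_ℝ * fderiv ℝ f (innerCoords h x) (Pi.single i 1)| ≤ C)
    {w : H} (hw : w ∈ cylSpan f h) :
    ∃ Aw ∈ cylSpan f h,
      HasDerivWithinAt (fun s => ContinuousLinearMap.adjoint (L s) w) Aw (Ici 0) 0 := by
  set Ag : H → H := fun x => ∑ i, fderiv ℝ f (innerCoords h x) (Pi.single i 1) • Ah i with hAg
  have hder (x : H) : HasDerivWithinAt
      (fun s => ContinuousLinearMap.adjoint (L s) (cylGradient f h x)) (Ag x) (Ici 0) 0 :=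
    hasDerivWithinAt_adjoint_sum_smul _ hdom
  have hAgadd : ∀ x, ∀ v ∈ (cylSpan f h)ᗮ, Ag (x + v) = Ag x := fun x v hv => by
    have h1 := hder (x + v)
    rw [cylGradient_add_orthogonal hf h x hv] at h1
    exact (uniqueDiffWithinAt_Ici (0 : ℝ)).eq_deriv _ h1 (hder x)
  have hbdd : ∀ x, |⟪x, Ag x⟫_ℝ| ≤ C := fun x => by
    refine le_of_eq_of_le ?_ (hC x)
    simp [hAg, inner_sum, inner_smul_right, mul_comm]
  have hAgmem : ∀ x, Ag x ∈ cylSpan f h := fun x => by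
    rw [← Submodule.orthogonal_orthogonal (cylSpan f h), Submodule.mem_orthogonal]
    intro v hv
    by_contra hne
    have h1 := hbdd (x + ((C + 1 - ⟪x, Ag x⟫_ℝ) / ⟪v, Ag x⟫_ℝ) • v)
    rw [hAgadd _ _ (Submodule.smul_mem _ _ hv), inner_add_left, real_inner_smul_left,
      div_mul_cancel₀ _ hne] at h1
    linarith [le_abs_self (⟪x, Ag x⟫_ℝ + (C + 1 - ⟪x, Ag x⟫_ℝ))]
  induction hw using Submodule.span_induction with
  | mem w hw =>
    obtain ⟨x, rfl⟩ := hw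
    exact ⟨Ag x, hAgmem x, hder x⟩
  | zero => exact ⟨0, Submodule.zero_mem _, by simpa using hasDerivWithinAt_const _ _ _⟩
  | add u v _ _ hu hv =>
    obtain ⟨Au, hAu, hu⟩ := hu
    obtain ⟨Av, hAv, hv⟩ := hv
    exact ⟨Au + Av, Submodule.add_mem _ hAu hAv, by simpa using! hu.add hv⟩
  | smul c u _ hu =>
    obtain ⟨Au, hAu, hu⟩ := hu
    exact ⟨c • Au, Submodule.smul_mem _ c hAu, by simpa using! hu.const_smul c⟩

/-- Second order expansion of a cylindrical function in coordinates of the span of its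
gradients. -/
theorem exists_cyl_expansion_bound {f : (Fin n → ℝ) → ℝ} (hf : ContDiff ℝ 3 f) {C : ℝ}
    (hC : ∀ z, ‖iteratedFDeriv ℝ 3 f z‖ ≤ C) (h : Fin n → H) (x : H) {κ : Type*} [Fintype κ]
    (b : OrthonormalBasis κ ℝ (cylSpan f h)) :
    ∃ K : ℝ, 0 ≤ K ∧ ∀ y, |f (innerCoords h y) - f (innerCoords h x) -
      ∑ k, ⟪cylGradient f h x, b k⟫_ℝ * ⟪y - x, b k⟫_ℝ -
      (1 / 2) * ∑ k, ∑ l, fderiv ℝ (fderiv ℝ f) (innerCoords h x) (innerCoords h (b k))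
        (innerCoords h (b l)) * (⟪y - x, b k⟫_ℝ * ⟪y - x, b l⟫_ℝ)| ≤
      K * ∑ k, |⟪y - x, b k⟫_ℝ| ^ 3 := by
  have hC0 : 0 ≤ C := (norm_nonneg _).trans (hC 0)
  refine ⟨C * (‖innerCoords h‖ ^ 3 * (Fintype.card κ : ℝ) ^ 2), by positivity, fun y => ?_⟩
  set u : H := ∑ k, ⟪y - x, b k⟫_ℝ • (b k : H) with hu
  have hy : f (innerCoords h y) = f (innerCoords h x + innerCoords h u) := by
    have := cyl_add_orthogonal (hf.differentiable (by norm_num)) h (x + u)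
      (sub_sum_inner_smul_mem_orthogonal b (y - x))
    rw [← hu, show x + u + (y - x - u) = y by abel, map_add] at this
    exact this
  have h1 : fderiv ℝ f (innerCoords h x) (innerCoords h u) =
      ∑ k, ⟪cylGradient f h x, b k⟫_ℝ * ⟪y - x, b k⟫_ℝ := by
    rw [fderiv_innerCoords_eq_inner, hu, inner_sum]
    exact Finset.sum_congr rfl fun k _ => by rw [real_inner_smul_right, mul_comm]
  have h2 : fderiv ℝ (fderiv ℝ f) (innerCoords h x) (innerCoords h u) (innerCoords h u) =
      ∑ k, ∑ l, fderiv ℝ (fderiv ℝ f) (innerCoords h x) (innerCoords h (b k))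
        (innerCoords h (b l)) * (⟪y - x, b k⟫_ℝ * ⟪y - x, b l⟫_ℝ) := by
    simp only [hu, map_sum, map_smul, sum_apply, smul_apply, smul_eq_mul, Finset.mul_sum]
    rw [Finset.sum_comm]
    exact Finset.sum_congr rfl fun k _ => Finset.sum_congr rfl fun l _ => by ring
  have hnorm : ‖u‖ ≤ ∑ k, |⟪y - x, b k⟫_ℝ| := by
    refine (norm_sum_le _ _).trans (Finset.sum_le_sum fun k _ => ?_)
    have : ‖(b k : H)‖ = 1 := b.orthonormal.1 k
    rw [norm_smul, this, mul_one, Real.norm_eq_abs]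
  have hcube : (∑ k, |⟪y - x, b k⟫_ℝ|) ^ 3 ≤
      (Fintype.card κ : ℝ) ^ 2 * ∑ k, |⟪y - x, b k⟫_ℝ| ^ 3 := by
    rcases isEmpty_or_nonempty κ with hκ | hκ
    · simp
    have := pow_sum_div_card_le_sum_pow (s := Finset.univ) (f := fun k => |⟪y - x, b k⟫_ℝ|)
      (fun k _ => abs_nonneg _) 2
    rwa [div_le_iff₀ (by simp [Fintype.card_pos]), Finset.card_univ, mul_comm] at this
  have := taylor_two_remainder_le hf hC (innerCoords h x) (innerCoords h u)
  rw [h1, h2, ← hy] at this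
  refine this.trans ?_
  rw [mul_assoc, mul_assoc]
  refine mul_le_mul_of_nonneg_left ?_ hC0
  calc ‖innerCoords h u‖ ^ 3 ≤ (‖innerCoords h‖ * ‖u‖) ^ 3 := by
        gcongr; exact (innerCoords h).le_opNorm u
    _ = ‖innerCoords h‖ ^ 3 * ‖u‖ ^ 3 := mul_pow _ _ _
    _ ≤ ‖innerCoords h‖ ^ 3 * (∑ k, |⟪y - x, b k⟫_ℝ|) ^ 3 := by gcongr
    _ ≤ _ := by gcongr

end Cylindrical

/-- generator formula (2.8) on the core `𝓕C_b^∞(A*)`: for cylindrical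
`φ(x) = f(⟨x,h₁⟩,…,⟨x,h_n⟩)` with `h_i ∈ dom(A*)` and
`sup_x |Σ_i ⟨x,A*h_i⟩ ∂_i f| < ∞`, the limit `lim_{t↓0} (P_tφ(x) − φ(x))/t` equals
`(1/2)Σ_{ij} B(h_i,h_j)∂_i∂_j f + Σ_i (⟨x,A*h_i⟩ + λ⟨b_H,h_i⟩ − ⟨b_H,A*h_i⟩)∂_i f`. -/
theorem gauss_markov_generator_on_core
    {H : Type} [NormedAddCommGroup H] [InnerProductSpace ℝ H] [CompleteSpace H]
    [TopologicalSpace.SeparableSpace H] [MeasurableSpace H] [BorelSpace H]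
    -- a C₀-semigroup L
    (L : ℝ → H →L[ℝ] H)
    (hL0 : L 0 = ContinuousLinearMap.id ℝ H)
    (hLsem : ∀ s ≥ (0:ℝ), ∀ t ≥ (0:ℝ), L (s + t) = (L s).comp (L t))
    (hLcont : ∀ x : H, ContinuousOn (fun t => L t x) (Ici 0))
    (lam : ℝ) (hlam : 0 < lam) (bH : H)
    -- a symmetric nonnegative bilinear form B on dom(A*)
    (B : H → H → ℝ)
    (hBsym : ∀ u Au v Av : H,
      HasDerivWithinAt (fun s => ContinuousLinearMap.adjoint (L s) u) Au (Ici 0) 0 →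
      HasDerivWithinAt (fun s => ContinuousLinearMap.adjoint (L s) v) Av (Ici 0) 0 →
      B u v = B v u)
    (hBadd : ∀ u Au v Av w Aw : H,
      HasDerivWithinAt (fun s => ContinuousLinearMap.adjoint (L s) u) Au (Ici 0) 0 →
      HasDerivWithinAt (fun s => ContinuousLinearMap.adjoint (L s) v) Av (Ici 0) 0 →
      HasDerivWithinAt (fun s => ContinuousLinearMap.adjoint (L s) w) Aw (Ici 0) 0 →
      B (u + v) w = B u w + B v w)
    (hBsmul : ∀ (c : ℝ) (u Au v Av : H),
      HasDerivWithinAt (fun s => ContinuousLinearMap.adjoint (L s) u) Au (Ici 0) 0 →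
      HasDerivWithinAt (fun s => ContinuousLinearMap.adjoint (L s) v) Av (Ici 0) 0 →
      B (c • u) v = c * B u v)
    (hBpos : ∀ u Au : H,
      HasDerivWithinAt (fun s => ContinuousLinearMap.adjoint (L s) u) Au (Ici 0) 0 →
      0 ≤ B u u)
    -- the Gaussian measures μ(t,x) with mean m(t,x) and covariance Q(t)
    (μ : ℝ → H → Measure H) (m : ℝ → H → H) (Q : ℝ → H →L[ℝ] H)
    (hprob : ∀ t ≥ (0:ℝ), ∀ x, IsProbabilityMeasure (μ t x))
    (hgauss : ∀ t > (0:ℝ), ∀ x, IsGaussianMeasure (μ t x))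
    (hmean : ∀ t ≥ (0:ℝ), ∀ x, m t x = ∫ y, y ∂(μ t x))
    (hcovdef : ∀ t ≥ (0:ℝ), ∀ x, ∀ h k : H,
      ⟪Q t h, k⟫_ℝ = ∫ y, ⟪y - m t x, h⟫_ℝ * ⟪y - m t x, k⟫_ℝ ∂(μ t x))
    -- the mean formula (2.3)
    (hmform : ∀ h Ah : H,
      HasDerivWithinAt (fun s => ContinuousLinearMap.adjoint (L s) h) Ah (Ici 0) 0 →
      ∀ x : H, ∀ t ≥ (0:ℝ),
        ⟪m t x, h⟫_ℝ =
          ⟪L t x, h⟫_ℝ + ∫ s in (0:ℝ)..t, (lam * ⟪L s bH, h⟫_ℝ - ⟪L s bH, Ah⟫_ℝ))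
    -- the covariance formula (2.5)
    (hQform : ∀ h Ah : H,
      HasDerivWithinAt (fun s => ContinuousLinearMap.adjoint (L s) h) Ah (Ici 0) 0 →
      ∀ t ≥ (0:ℝ), ⟪Q t h, h⟫_ℝ =
        ∫ s in (0:ℝ)..t,
          B (ContinuousLinearMap.adjoint (L s) h) (ContinuousLinearMap.adjoint (L s) h))
    -- Q(t) is of trace class
    (ι : Type) (e : HilbertBasis ι ℝ H)
    (htrace : ∀ t ≥ (0:ℝ), Summable (fun i => ⟪Q t (e i), e i⟫_ℝ))
    -- the cylindrical function φ
    (n : ℕ) (hn : 1 ≤ n) (f : (Fin n → ℝ) → ℝ)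
    (hf : ContDiff ℝ (⊤ : ℕ∞) f)
    (hfbdd : ∀ k : ℕ, ∃ C : ℝ, ∀ z, ‖iteratedFDeriv ℝ k f z‖ ≤ C)
    (h : Fin n → H) (Ah : Fin n → H)
    (hdom : ∀ i, HasDerivWithinAt
      (fun s => ContinuousLinearMap.adjoint (L s) (h i)) (Ah i) (Ici 0) 0)
    (hsup : ∃ C : ℝ, ∀ x : H,
      |∑ i, ⟪x, Ah i⟫_ℝ * fderiv ℝ f (fun j => ⟪x, h j⟫_ℝ) (Pi.single i 1)| ≤ C) :
    ∀ x : H,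
      Tendsto
        (fun t => (1 / t) *
          ((∫ y, f (fun j => ⟪y, h j⟫_ℝ) ∂(μ t x)) - f (fun j => ⟪x, h j⟫_ℝ)))
        (nhdsWithin 0 (Ioi 0))
        (nhds
          ((1 / 2) * ∑ i, ∑ j, B (h i) (h j) *
              fderiv ℝ (fun z => fderiv ℝ f z (Pi.single i 1))
                (fun j' => ⟪x, h j'⟫_ℝ) (Pi.single j 1) +
            ∑ i, (⟪x, Ah i⟫_ℝ + lam * ⟪bH, h i⟫_ℝ - ⟪bH, Ah i⟫_ℝ) *
              fderiv ℝ f (fun j => ⟪x, h j⟫_ℝ) (Pi.single i 1))) := by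
  intro x
  have : SecondCountableTopology H := UniformSpace.secondCountable_of_separable H
  set D : Submodule ℝ H :=
    { carrier := {u | ∃ Au, HasDerivWithinAt (fun s => ContinuousLinearMap.adjoint (L s) u) Au
        (Ici 0) 0}
      add_mem' := fun ⟨Au, hu⟩ ⟨Av, hv⟩ => ⟨Au + Av, by simpa using! hu.add hv⟩
      zero_mem' := ⟨0, by simpa using hasDerivWithinAt_const _ _ _⟩
      smul_mem' := fun c _ ⟨Au, hu⟩ => ⟨c • Au, by simpa using! hu.const_smul c⟩ } with hD
  obtain ⟨β, hβ⟩ := exists_bilin_eqOn_submodule D B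
    (fun u ⟨Au, hu⟩ v ⟨Av, hv⟩ => hBsym u Au v Av hu hv)
    (fun u ⟨Au, hu⟩ v ⟨Av, hv⟩ w ⟨Aw, hw⟩ => hBadd u Au v Av w Aw hu hv hw)
    (fun c u ⟨Au, hu⟩ v ⟨Av, hv⟩ => hBsmul c u Au v Av hu hv)
  obtain ⟨C, hC⟩ := hsup
  simp only [← innerCoords_apply] at hC ⊢
  set W := cylSpan f h with hWdef
  have hW : ∀ w ∈ W, ∃ Aw ∈ W,
      HasDerivWithinAt (fun s => ContinuousLinearMap.adjoint (L s) w) Aw (Ici 0) 0 :=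
    fun w hw => exists_adjoint_deriv_mem_cylSpan (hf.differentiable (by simp)) hdom hC hw
  have hWD : ∀ w ∈ W, w ∈ D := fun w hw => (hW w hw).imp fun _ h => h.2
  -- covariance asymptotics on the invariant subspace
  have hquad : ∀ w ∈ W, Tendsto (fun t => ⟪Q t w, w⟫_ℝ / t) (nhdsWithin 0 (Ioi 0))
      (nhds (β w w)) := fun w hw => by
    refine (tendsto_intervalIntegral_bilin_div hL0 hLsem hLcont hW β hw).congr' ?_
    filter_upwards [self_mem_nhdsWithin] with t ht
    obtain ⟨Aw, hAw⟩ := hWD w hw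
    rw [hQform w Aw hAw t (le_of_lt ht)]
    congr 1
    refine intervalIntegral.integral_congr fun s hs => ?_
    rw [uIcc_of_le (le_of_lt ht)] at hs
    have := hWD _ (adjoint_semigroup_mem_of_invariant hL0 hLsem hLcont hW hw hs.1)
    exact hβ _ this _ this
  have hcov : ∀ u ∈ W, ∀ v ∈ W, Tendsto (fun t => ⟪Q t u, v⟫_ℝ / t) (nhdsWithin 0 (Ioi 0))
      (nhds (β u v)) := fun u hu v hv => by
    have hlim := (((hquad _ (W.add_mem hu hv)).sub (hquad u hu)).sub (hquad v hv)).div_const 2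
    have hsym : β v u = β u v := by
      obtain ⟨Au, hAu⟩ := hWD u hu
      obtain ⟨Av, hAv⟩ := hWD v hv
      rw [hβ v ⟨Av, hAv⟩ u ⟨Au, hAu⟩, hβ u ⟨Au, hAu⟩ v ⟨Av, hAv⟩, hBsym v Av u Au hAv hAu]
    have hval : (β (u + v) (u + v) - β u u - β v v) / 2 = β u v := by
      simp only [map_add, LinearMap.add_apply, hsym]; ring
    rw [hval] at hlim
    refine hlim.congr' ?_
    filter_upwards [self_mem_nhdsWithin] with t ht
    have hQsym : ⟪Q t v, u⟫_ℝ = ⟪Q t u, v⟫_ℝ := by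
      rw [hcovdef t (le_of_lt ht) x, hcovdef t (le_of_lt ht) x]
      simp only [mul_comm]
    simp only [map_add, inner_add_left, inner_add_right, hQsym]
    ring
  set b := stdOrthonormalBasis ℝ W with hb
  choose Ab hAbW hAb using fun k => hW (b k) (b k).2
  obtain ⟨C₃, hC₃⟩ := hfbdd 3
  obtain ⟨M, hM⟩ := hfbdd 0
  have hM' : ∀ z, |f z| ≤ M := fun z => by simpa using hM z
  obtain ⟨K, hK0, hK⟩ := exists_cyl_expansion_bound (contDiff_infty.1 hf 3) hC₃ h x b
  have hlim := tendsto_integral_gaussian_of_expansion (fun t => μ t x)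
    (fun t ht => isGaussian_of_map_eq_gaussianReal (hgauss t ht x)) x (fun k => (b k : H))
    (fun k => ⟪x, Ab k⟫_ℝ + lam * ⟪bH, b k⟫_ℝ - ⟪bH, Ab k⟫_ℝ) (fun k l => β (b k) (b l))
    (fun k => by
      refine (tendsto_mean_increment_div hL0 hLsem hLcont (hAb k) lam bH x).congr' ?_
      filter_upwards [self_mem_nhdsWithin] with t ht
      rw [← hmean t (le_of_lt ht), inner_sub_left, hmform _ _ (hAb k) x t (le_of_lt ht)])
    (fun k l => by
      refine (hcov _ (b k).2 _ (b l).2).congr' ?_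
      filter_upwards [self_mem_nhdsWithin] with t ht
      rw [← hmean t (le_of_lt ht), hcovdef t (le_of_lt ht) x])
    (fun y => f (innerCoords h y)) (hf.continuous.comp (innerCoords h).continuous)
    (fun y => hM' _) _ _ hK hK0
  have hgrad := eq_sum_inner_smul_of_mem b (cylGradient_mem_cylSpan f h x)
  have hAgrad : ∑ i, fderiv ℝ f (innerCoords h x) (Pi.single i 1) • Ah i =
      ∑ k, ⟪cylGradient f h x, b k⟫_ℝ • Ab k := by
    have h1 := hasDerivWithinAt_adjoint_sum_smul
      (fun i => fderiv ℝ f (innerCoords h x) (Pi.single i 1)) hdom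
    have h2 := hasDerivWithinAt_adjoint_sum_smul (fun k => ⟪cylGradient f h x, b k⟫_ℝ) hAb
    rw [← hgrad] at h2
    exact (uniqueDiffWithinAt_Ici (0 : ℝ)).eq_deriv _ h1 h2
  have hdrift : ∑ k, ⟪cylGradient f h x, b k⟫_ℝ *
      (⟪x, Ab k⟫_ℝ + lam * ⟪bH, b k⟫_ℝ - ⟪bH, Ab k⟫_ℝ) =
      ∑ i, (⟪x, Ah i⟫_ℝ + lam * ⟪bH, h i⟫_ℝ - ⟪bH, Ah i⟫_ℝ) *
        fderiv ℝ f (innerCoords h x) (Pi.single i 1) := by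
    have expand : ∀ {κ : Type} [Fintype κ] (c : κ → ℝ) (u Au : κ → H),
        ∑ k, c k * (⟪x, Au k⟫_ℝ + lam * ⟪bH, u k⟫_ℝ - ⟪bH, Au k⟫_ℝ) =
          ⟪x, ∑ k, c k • Au k⟫_ℝ + lam * ⟪bH, ∑ k, c k • u k⟫_ℝ -
            ⟪bH, ∑ k, c k • Au k⟫_ℝ := fun c u Au => by
      simp only [inner_sum, inner_smul_right, Finset.mul_sum, ← Finset.sum_add_distrib,
        ← Finset.sum_sub_distrib]
      exact Finset.sum_congr rfl fun k _ => by ring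
    rw [expand _ (fun k => (b k : H)), ← hgrad, ← hAgrad]
    simp only [mul_comm _ (fderiv ℝ f (innerCoords h x) _)]
    rw [expand]
    rfl
  have hB : ∑ i, ∑ j, B (h i) (h j) * fderiv ℝ (fun z => fderiv ℝ f z (Pi.single i 1))
      (innerCoords h x) (Pi.single j 1) =
      ∑ i, ∑ j, β (h i) (h j) * fderiv ℝ (fun z => fderiv ℝ f z (Pi.single i 1))
      (innerCoords h x) (Pi.single j 1) :=
    Finset.sum_congr rfl fun i _ => Finset.sum_congr rfl fun j _ => by
      rw [hβ _ ⟨Ah i, hdom i⟩ _ ⟨Ah j, hdom j⟩]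
  rw [hB, sum_bilin_sndFDeriv_eq (contDiff_infty.1 hf 2) h x β b, ← hdrift]
  exact hlim
end

section
/- Let (L(t))_{t≥0} be a family of bounded linear operators on H with ‖L(t)‖ ≤ M e^{λ₀ t} for all t ≥ 0, where M ≥ 1 and λ₀ > 0. Let g : [0,∞) → H satisfy g(t+s) = L(t)g(s) + g(t) for all s,t ≥ 0 and sup_{s∈[0,1]} ‖g(s)‖ < ∞. Then there exists C > 0 such that ‖g(t)‖ ≤ C e^{λ₀ t} for all t ≥ 0. -/
open Set

/-- Lemma 3.4: if `‖L(t)‖ ≤ M e^{λ₀ t}`, `g(t+s) = L(t)g(s) + g(t)` and `g`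
is bounded on `[0,1]`, then `‖g(t)‖ ≤ C e^{λ₀ t}` for some `C > 0`. -/
theorem cocycle_exponential_bound
    {H : Type} [NormedAddCommGroup H] [InnerProductSpace ℝ H] [CompleteSpace H]
    [TopologicalSpace.SeparableSpace H]
    (L : ℝ → H →L[ℝ] H) (M lam₀ : ℝ) (hM : 1 ≤ M) (hlam₀ : 0 < lam₀)
    (hLbound : ∀ t ≥ (0:ℝ), ‖L t‖ ≤ M * Real.exp (lam₀ * t))
    (g : ℝ → H)
    (hgcoc : ∀ s ≥ (0:ℝ), ∀ t ≥ (0:ℝ), g (t + s) = L t (g s) + g t)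
    (hgbdd : ∃ K : ℝ, ∀ s ∈ Icc (0:ℝ) 1, ‖g s‖ ≤ K) :
    ∃ C > (0:ℝ), ∀ t ≥ (0:ℝ), ‖g t‖ ≤ C * Real.exp (lam₀ * t) := by
  obtain ⟨K, hK⟩ := hgbdd
  have hK0 : 0 ≤ K := (norm_nonneg _).trans (hK 0 (by simp))
  have hexp : 0 < Real.exp lam₀ - 1 := sub_pos.2 (Real.one_lt_exp_iff.2 hlam₀)
  have hMK : 0 ≤ M * K / (Real.exp lam₀ - 1) := by positivity
  set C := K + 1 + M * K / (Real.exp lam₀ - 1) with hC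
  have hC0 : 0 < C := by positivity
  have hCstep : M * K + C ≤ C * Real.exp lam₀ := by
    have hdiv : M * K / (Real.exp lam₀ - 1) * (Real.exp lam₀ - 1) = M * K :=
      div_mul_cancel₀ _ hexp.ne'
    have hpos : 0 ≤ (K + 1) * (Real.exp lam₀ - 1) := by positivity
    have hsplit : C * (Real.exp lam₀ - 1) = (K + 1) * (Real.exp lam₀ - 1) + M * K := by
      rw [hC, add_mul, hdiv]
    linarith
  have hbound : ∀ n : ℕ, ∀ t ≥ (0:ℝ), t ≤ n + 1 → ‖g t‖ ≤ C * Real.exp (lam₀ * t) := by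
    have hunit : ∀ t ≥ (0:ℝ), t ≤ 1 → ‖g t‖ ≤ C * Real.exp (lam₀ * t) := fun t ht ht1 =>
      calc ‖g t‖ ≤ K := hK t ⟨ht, ht1⟩
        _ ≤ C := by linarith
        _ ≤ C * Real.exp (lam₀ * t) :=
          le_mul_of_one_le_right hC0.le (Real.one_le_exp (by positivity))
    intro n
    induction n with
    | zero => simpa using hunit
    | succ n ih =>
      intro t ht htn
      rcases le_total t 1 with ht1 | ht1
      · exact hunit t ht ht1
      obtain ⟨u, rfl⟩ : ∃ u, t = u + 1 := ⟨t - 1, by ring⟩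
      have hu : 0 ≤ u := by linarith
      push_cast at htn
      calc ‖g (u + 1)‖ = ‖L u (g 1) + g u‖ := by rw [hgcoc 1 zero_le_one u hu]
        _ ≤ ‖L u‖ * ‖g 1‖ + ‖g u‖ :=
          (norm_add_le _ _).trans (add_le_add_left ((L u).le_opNorm _) _)
        _ ≤ M * Real.exp (lam₀ * u) * K + C * Real.exp (lam₀ * u) := by
          gcongr
          · exact hLbound u hu
          · exact hK 1 (by simp)
          · exact ih u hu (by linarith)
        _ = (M * K + C) * Real.exp (lam₀ * u) := by ring
        _ ≤ C * Real.exp lam₀ * Real.exp (lam₀ * u) := by gcongr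
        _ = C * Real.exp (lam₀ * (u + 1)) := by
          rw [mul_assoc, ← Real.exp_add]
          ring_nf
  refine ⟨C, hC0, fun t ht => ?_⟩
  obtain ⟨n, hn⟩ := exists_nat_ge t
  exact hbound n t ht (by linarith)
end

section
/- Let {μ(t,x)} be a Gaussian transition family on H satisfying Hypothesis 2.1, suppose L(t)x := m(t,x) − m(t,0) defines a C0-semigroup (L(t)) on H, that Q(t) := Q(t,x) is independent of x, and set g(t) := m(t,0). Then for all s,t ≥ 0: g(t+s) = L(t)g(s) + g(t) and Q(t+s) = Q(t) + L(t) Q(s) L(t)*. -/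
open MeasureTheory ProbabilityTheory Set Filter
open scoped InnerProductSpace NNReal

section Convolution

variable {E : Type*} [NormedAddCommGroup E] [MeasurableSpace E] [BorelSpace E]
  [SecondCountableTopology E]

lemma integral_id_conv [NormedSpace ℝ E] {α β : Measure E} [IsProbabilityMeasure α] [IsProbabilityMeasure β]
    (hα : Integrable id α) (hβ : Integrable id β) :
    ∫ z, z ∂(α ∗ β) = ∫ x, x ∂α + ∫ y, y ∂β := by
  have h₁ : Integrable (fun p : E × E ↦ p.1) (α.prod β) := hα.comp_fst β
  have h₂ : Integrable (fun p : E × E ↦ p.2) (α.prod β) := hβ.comp_snd α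
  rw [Measure.conv, integral_map (by fun_prop) (by fun_prop), integral_add h₁ h₂]
  simp [integral_fun_fst (fun x : E ↦ x), integral_fun_snd (fun x : E ↦ x)]

lemma memLp_id_conv {α β : Measure E} [IsProbabilityMeasure α] [IsProbabilityMeasure β]
    {p : ENNReal} (hα : MemLp id p α) (hβ : MemLp id p β) : MemLp id p (α ∗ β) := by
  rw [Measure.conv, memLp_map_measure_iff (by fun_prop) (by fun_prop)]
  exact (hα.comp_fst β).add (hβ.comp_snd α)

lemma covarianceBilin_conv [InnerProductSpace ℝ E] [CompleteSpace E] {α β : Measure E}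
    [IsProbabilityMeasure α] [IsProbabilityMeasure β]
    (hα : MemLp id 2 α) (hβ : MemLp id 2 β) (h k : E) :
    covarianceBilin (α ∗ β) h k = covarianceBilin α h k + covarianceBilin β h k := by
  have hα' (u : E) : MemLp (fun x ↦ ⟪u, x⟫_ℝ) 2 α := hα.const_inner u
  have hβ' (u : E) : MemLp (fun x ↦ ⟪u, x⟫_ℝ) 2 β := hβ.const_inner u
  have hX (u : E) := (hα' u).comp_fst β
  have hY (u : E) := (hβ' u).comp_snd α
  have hXX : cov[fun p : E × E ↦ ⟪h, p.1⟫_ℝ, fun p ↦ ⟪k, p.1⟫_ℝ; α.prod β] =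
      cov[fun x ↦ ⟪h, x⟫_ℝ, fun x ↦ ⟪k, x⟫_ℝ; α] := by
    conv_rhs => rw [← (measurePreserving_fst (μ := α) (ν := β)).map_eq]
    rw [covariance_map_fun (by fun_prop) (by fun_prop) (by fun_prop)]
  have hYY : cov[fun p : E × E ↦ ⟪h, p.2⟫_ℝ, fun p ↦ ⟪k, p.2⟫_ℝ; α.prod β] =
      cov[fun x ↦ ⟪h, x⟫_ℝ, fun x ↦ ⟪k, x⟫_ℝ; β] := by
    conv_rhs => rw [← (measurePreserving_snd (μ := α) (ν := β)).map_eq]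
    rw [covariance_map_fun (by fun_prop) (by fun_prop) (by fun_prop)]
  have hXY (u v : E) : cov[fun p : E × E ↦ ⟪u, p.1⟫_ℝ, fun p ↦ ⟪v, p.2⟫_ℝ; α.prod β] = 0 :=
    covariance_fst_snd_prod (hα' u) (hβ' v)
  have hsum (u : E) : (fun p : E × E ↦ ⟪u, p.1 + p.2⟫_ℝ) =
      (fun p : E × E ↦ ⟪u, p.1⟫_ℝ) + fun p : E × E ↦ ⟪u, p.2⟫_ℝ := by
    ext p; simp [inner_add_right]
  rw [covarianceBilin_apply_eq_cov (memLp_id_conv hα hβ), covarianceBilin_apply_eq_cov hα,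
    covarianceBilin_apply_eq_cov hβ, Measure.conv,
    covariance_map_fun (by fun_prop) (by fun_prop) (by fun_prop), hsum, hsum,
    covariance_add_left (hX h) (hY h) ((hX k).add (hY k)), covariance_add_right (hX h) (hX k) (hY k),
    covariance_add_right (hY h) (hX k) (hY k), hXX, hYY, hXY,
    covariance_comm (fun p : E × E ↦ ⟪h, p.2⟫_ℝ), hXY]
  ring

end Convolution

/-- identities (3.14) and (3.15): with `g(t) = m(t,0)` and `Q(t) = Q(t,x)`,
one has `g(t+s) = L(t)g(s) + g(t)` and `Q(t+s) = Q(t) + L(t)Q(s)L(t)*`. -/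
theorem gauss_markov_cocycle_identities
    {H : Type} [NormedAddCommGroup H] [InnerProductSpace ℝ H] [CompleteSpace H]
    [TopologicalSpace.SeparableSpace H] [MeasurableSpace H] [BorelSpace H]
    (μ : ℝ → H → Measure H) (m : ℝ → H → H) (Q : ℝ → H → H →L[ℝ] H)
    -- Gaussian transition family
    (hprob : ∀ t ≥ (0:ℝ), ∀ x, IsProbabilityMeasure (μ t x))
    (hdirac : ∀ x, μ 0 x = Measure.dirac x)
    (hgauss : ∀ t > (0:ℝ), ∀ x, IsGaussianMeasure (μ t x))
    (hmean : ∀ t ≥ (0:ℝ), ∀ x, m t x = ∫ y, y ∂(μ t x))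
    (hcov : ∀ t ≥ (0:ℝ), ∀ x, ∀ h k : H,
      ⟪Q t x h, k⟫_ℝ = ∫ y, ⟪y - m t x, h⟫_ℝ * ⟪y - m t x, k⟫_ℝ ∂(μ t x))
    (hCK : ∀ s ≥ (0:ℝ), ∀ t ≥ (0:ℝ), ∀ x, ∀ B : Set H, MeasurableSet B →
      μ (s + t) x B = ∫⁻ y, μ t y B ∂(μ s x))
    -- Hypothesis 2.1
    (hyp1m : ∀ (x h : H), ContinuousOn (fun t => ⟪m t x, h⟫_ℝ) (Ici 0))
    (hyp1Q : ∀ (x h k : H), ContinuousOn (fun t => ⟪Q t x h, k⟫_ℝ) (Ici 0))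
    (hyp2m : ∀ t ≥ (0:ℝ), ∀ h : H, Continuous (fun x => ⟪m t x, h⟫_ℝ))
    (hyp2Q : ∀ t ≥ (0:ℝ), ∀ h k : H, Continuous (fun x => ⟪Q t x h, k⟫_ℝ))
    (hyp3 : ∀ t > (0:ℝ), ∀ x, Dense (Set.range (Q t x)))
    -- L(t)x := m(t,x) − m(t,0) defines a C₀-semigroup
    (L : ℝ → H →L[ℝ] H)
    (hLdef : ∀ t ≥ (0:ℝ), ∀ x, L t x = m t x - m t 0)
    (hL0 : L 0 = ContinuousLinearMap.id ℝ H)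
    (hLsem : ∀ s ≥ (0:ℝ), ∀ t ≥ (0:ℝ), L (s + t) = (L s).comp (L t))
    (hLcont : ∀ x, ContinuousOn (fun t => L t x) (Ici 0))
    -- Q(t) := Q(t,x) is independent of x
    (hQind : ∀ t ≥ (0:ℝ), ∀ x y, Q t x = Q t y) :
    ∀ s ≥ (0:ℝ), ∀ t ≥ (0:ℝ),
      m (t + s) 0 = L t (m s 0) + m t 0 ∧
      Q (t + s) 0 = Q t 0 + (L t).comp ((Q s 0).comp (ContinuousLinearMap.adjoint (L t))) := by
  have : SecondCountableTopology H := UniformSpace.secondCountable_of_separable H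
  have hG : ∀ t ≥ (0:ℝ), ∀ x, IsGaussian (μ t x) := by
    intro t ht x
    rcases ht.eq_or_lt with rfl | ht
    · rw [hdirac]
      infer_instance
    · exact isGaussian_of_map_eq_gaussianReal (hgauss t ht x)
  have hcov' : ∀ t ≥ (0:ℝ), ∀ x h k, covarianceBilin (μ t x) h k = ⟪Q t x h, k⟫_ℝ := by
    intro t ht x h k
    have := hG t ht x
    rw [covarianceBilin_apply IsGaussian.memLp_two_id, hcov t ht, hmean t ht]
    simp [real_inner_comm]
  have htrans : ∀ t ≥ (0:ℝ), ∀ y, μ t y = (μ t 0).map (fun z ↦ L t y + z) := by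
    intro t ht y
    have := hG t ht
    apply IsGaussian.ext
    · rw [integral_map (by fun_prop) (by fun_prop)]
      simp only [id_eq]
      rw [integral_add (integrable_const _) IsGaussian.integrable_fun_id, ← hmean t ht, ← hmean t ht, hLdef t ht]
      simp
    · rw [covarianceBilin_map_const_add]
      ext h k
      rw [hcov' t ht, hcov' t ht, hQind t ht y 0]
  intro s hs t ht
  have := hG t ht 0
  have := hG s hs 0
  have hconv : μ (t + s) 0 = (μ s 0).map (L t) ∗ μ t 0 := by
    ext B hB
    have hB' : MeasurableSet ((fun p : H × H ↦ p.1 + p.2) ⁻¹' B) := measurable_add hB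
    rw [add_comm t s, hCK s hs t ht 0 B hB, Measure.conv,
      Measure.map_apply (by fun_prop) hB, Measure.prod_apply hB',
      lintegral_map (measurable_measure_prodMk_left hB') (by fun_prop)]
    refine lintegral_congr fun y ↦ ?_
    rw [htrans t ht y, Measure.map_apply (by fun_prop) hB]
    rfl
  have hts : 0 ≤ t + s := by positivity
  constructor
  · rw [hmean _ hts, hconv, integral_id_conv IsGaussian.integrable_id IsGaussian.integrable_id,
      integral_map (by fun_prop) (by fun_prop), ← hmean t ht,
      (L t).integral_comp_comm IsGaussian.integrable_fun_id, ← hmean s hs]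
  · refine ContinuousLinearMap.ext fun h ↦ ext_inner_right ℝ fun k ↦ ?_
    rw [← hcov' _ hts, hconv,
      covarianceBilin_conv IsGaussian.memLp_two_id IsGaussian.memLp_two_id,
      covarianceBilin_map IsGaussian.memLp_two_id, hcov' s hs, hcov' t ht]
    simp [inner_add_left, ContinuousLinearMap.adjoint_inner_right, add_comm]
end

section
/- Let (L(t))_{t≥0} be a family of bounded linear operators on H with ‖L(t)‖ ≤ M e^{λ₀ t} (M ≥ 1, λ₀ > 0). Let Q : [0,∞) → bounded nonnegative selfadjoint operators on H satisfy Q(t+s) = Q(t) + L(t) Q(s) L(t)* for all s,t ≥ 0, and suppose that for a fixed orthonormal basis (e_i) of H one has sup_{s∈[0,1]} Σ_i ⟨Q(s)e_i, e_i⟩ < ∞. Then there exists C > 0 such that Σ_i ⟨Q(t)e_i, e_i⟩ ≤ C e^{2λ₀ t} for all t ≥ 0. -/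
open Set
open scoped InnerProductSpace

open ContinuousLinearMap MatrixOrder in
/-- The values of a positive form on finitely many vectors form a Gram matrix. -/
theorem exists_gram_factor {H : Type*} [NormedAddCommGroup H] [InnerProductSpace ℝ H]
    [CompleteSpace H] (Q : H →L[ℝ] H) (hsa : adjoint Q = Q) (hpos : ∀ h : H, 0 ≤ ⟪Q h, h⟫_ℝ)
    {κ : Type*} [Fintype κ] (u : κ → H) :
    ∃ B : κ → κ → ℝ, ∀ j k, ⟪Q (u j), u k⟫_ℝ = ∑ l, B l j * B l k := by
  classical
  have hsymm : ∀ x y : H, ⟪Q x, y⟫_ℝ = ⟪Q y, x⟫_ℝ := fun x y => by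
    rw [real_inner_comm, ← adjoint_inner_left, hsa]
  have hps : (Matrix.of fun j k => ⟪Q (u j), u k⟫_ℝ).PosSemidef := by
    refine Matrix.PosSemidef.of_dotProduct_mulVec_nonneg ?_ fun x => ?_
    · ext j k
      simp [hsymm (u k) (u j)]
    · refine (hpos (∑ j, x j • u j)).trans_eq ?_
      simp only [map_sum, map_smul, sum_inner, inner_sum, real_inner_smul_left,
        real_inner_smul_right, dotProduct, Matrix.mulVec, Matrix.of_apply, star_trivial,
        Finset.mul_sum]
      refine Finset.sum_congr rfl fun j _ => Finset.sum_congr rfl fun k _ => ?_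
      rw [hsymm (u k) (u j)]
      ring
  obtain ⟨B, hB⟩ := CStarAlgebra.nonneg_iff_eq_star_mul_self.mp hps.nonneg
  refine ⟨B, fun j k => ?_⟩
  simpa [Matrix.mul_apply, Matrix.star_apply] using congrFun (congrFun hB j) k

open ContinuousLinearMap in
/-- Finite-rank version of `tr (T Q T*) ≤ ‖T‖² tr Q`. -/
theorem sum_inner_conj_truncation_le {H : Type*} [NormedAddCommGroup H] [InnerProductSpace ℝ H]
    [CompleteSpace H] (Q T : H →L[ℝ] H) (hsa : adjoint Q = Q) (hpos : ∀ h : H, 0 ≤ ⟪Q h, h⟫_ℝ)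
    {ι : Type*} {e : ι → H} (he : Orthonormal ℝ e) (F G : Finset ι) :
    ∑ i ∈ F, ⟪Q (∑ j ∈ G, ⟪e j, adjoint T (e i)⟫_ℝ • e j),
        ∑ j ∈ G, ⟪e j, adjoint T (e i)⟫_ℝ • e j⟫_ℝ
      ≤ ‖T‖ ^ 2 * ∑ j ∈ G, ⟪Q (e j), e j⟫_ℝ := by
  classical
  obtain ⟨B, hB⟩ := exists_gram_factor Q hsa hpos (fun j : G => e j)
  let v : G → H := fun l => ∑ j : G, B l j • e j
  have hv : ∀ l, ‖v l‖ ^ 2 = ∑ j, B l j ^ 2 := fun l => by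
    have he' : Orthonormal ℝ (fun j : G => e j) := he.comp _ Subtype.val_injective
    rw [← real_inner_self_eq_norm_sq]
    simp only [v]
    rw [he'.inner_sum]
    simp [sq]
  have hterm : ∀ i, ⟪Q (∑ j ∈ G, ⟪e j, adjoint T (e i)⟫_ℝ • e j),
      ∑ j ∈ G, ⟪e j, adjoint T (e i)⟫_ℝ • e j⟫_ℝ = ∑ l, ⟪e i, T (v l)⟫_ℝ ^ 2 := fun i => by
    have hinner : ∀ l, ⟪e i, T (v l)⟫_ℝ = ∑ j : G, B l j * ⟪e j, adjoint T (e i)⟫_ℝ := fun l => by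
      rw [← adjoint_inner_left, real_inner_comm]
      simp [v, sum_inner, real_inner_smul_left]
    rw [← Finset.sum_coe_sort G]
    simp only [map_sum, map_smul, sum_inner, inner_sum, real_inner_smul_left,
      real_inner_smul_right, hB, hinner, sq, Finset.sum_mul, Finset.mul_sum]
    rw [Finset.sum_comm_cycle]
    refine Finset.sum_congr rfl fun l _ => ?_
    rw [Finset.sum_comm]
    refine Finset.sum_congr rfl fun j _ => Finset.sum_congr rfl fun k _ => ?_
    ring
  calc _ = ∑ l, ∑ i ∈ F, ⟪e i, T (v l)⟫_ℝ ^ 2 := by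
        rw [Finset.sum_congr rfl fun i _ => hterm i, Finset.sum_comm]
    _ ≤ ∑ l, ‖T‖ ^ 2 * ‖v l‖ ^ 2 := by
        refine Finset.sum_le_sum fun l _ => ?_
        have h := he.sum_inner_products_le (T (v l)) (s := F)
        simp only [Real.norm_eq_abs, sq_abs] at h
        refine h.trans ?_
        rw [← mul_pow]
        gcongr
        exact T.le_opNorm _
    _ = ‖T‖ ^ 2 * ∑ j ∈ G, ⟪Q (e j), e j⟫_ℝ := by
        rw [← Finset.mul_sum, ← Finset.sum_coe_sort G]
        simp only [hv, hB, sq]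
        rw [Finset.sum_comm]

open ContinuousLinearMap in
/-- `tr (T Q T*) ≤ ‖T‖² tr Q` for a positive operator `Q` of finite trace. -/
theorem summable_and_tsum_inner_conj_le {H : Type*} [NormedAddCommGroup H]
    [InnerProductSpace ℝ H] [CompleteSpace H] (Q T : H →L[ℝ] H) (hsa : adjoint Q = Q)
    (hpos : ∀ h : H, 0 ≤ ⟪Q h, h⟫_ℝ) {ι : Type*} (e : HilbertBasis ι ℝ H)
    (hsum : Summable fun i => ⟪Q (e i), e i⟫_ℝ) :
    Summable (fun i => ⟪Q (adjoint T (e i)), adjoint T (e i)⟫_ℝ) ∧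
      ∑' i, ⟪Q (adjoint T (e i)), adjoint T (e i)⟫_ℝ ≤ ‖T‖ ^ 2 * ∑' i, ⟪Q (e i), e i⟫_ℝ := by
  have hfin : ∀ F : Finset ι, ∑ i ∈ F, ⟪Q (adjoint T (e i)), adjoint T (e i)⟫_ℝ ≤
      ‖T‖ ^ 2 * ∑' i, ⟪Q (e i), e i⟫_ℝ := fun F => by
    have hlim : ∀ i, Filter.Tendsto (fun G => ∑ j ∈ G, ⟪e j, adjoint T (e i)⟫_ℝ • e j)
        Filter.atTop (nhds (adjoint T (e i))) := fun i => by
      have h := e.hasSum_repr (adjoint T (e i))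
      simp only [e.repr_apply_apply] at h
      exact h
    refine le_of_tendsto (tendsto_finsetSum F fun i _ =>
      (((Q.continuous.tendsto _).comp (hlim i)).inner (hlim i))) (Filter.Eventually.of_forall ?_)
    intro G
    refine (sum_inner_conj_truncation_le Q T hsa hpos e.orthonormal F G).trans ?_
    gcongr
    exact hsum.sum_le_tsum G fun i _ => hpos _
  have hnonneg : ∀ i, 0 ≤ ⟪Q (adjoint T (e i)), adjoint T (e i)⟫_ℝ := fun i => hpos _
  exact ⟨summable_of_sum_le hnonneg hfin, Real.tsum_le_of_sum_le hnonneg hfin⟩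

/-- Lemma 3.6: if `Q(t+s) = Q(t) + L(t)Q(s)L(t)*`, `‖L(t)‖ ≤ M e^{λ₀t}`
and the traces `Σ_i ⟨Q(s)e_i,e_i⟩` are uniformly bounded on `[0,1]`, then
`Σ_i ⟨Q(t)e_i,e_i⟩ ≤ C e^{2λ₀ t}` for some `C > 0`. -/
theorem covariance_trace_exponential_bound
    {H : Type} [NormedAddCommGroup H] [InnerProductSpace ℝ H] [CompleteSpace H]
    [TopologicalSpace.SeparableSpace H]
    (L : ℝ → H →L[ℝ] H) (M lam₀ : ℝ) (hM : 1 ≤ M) (hlam₀ : 0 < lam₀)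
    (hLbound : ∀ t ≥ (0:ℝ), ‖L t‖ ≤ M * Real.exp (lam₀ * t))
    -- bounded nonnegative selfadjoint operators Q(t)
    (Q : ℝ → H →L[ℝ] H)
    (hQsa : ∀ t ≥ (0:ℝ), ContinuousLinearMap.adjoint (Q t) = Q t)
    (hQpos : ∀ t ≥ (0:ℝ), ∀ h : H, 0 ≤ ⟪Q t h, h⟫_ℝ)
    (hQcoc : ∀ s ≥ (0:ℝ), ∀ t ≥ (0:ℝ),
      Q (t + s) = Q t + (L t).comp ((Q s).comp (ContinuousLinearMap.adjoint (L t))))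
    -- a fixed orthonormal basis and the uniform trace bound on [0,1]
    (ι : Type) (e : HilbertBasis ι ℝ H)
    (hbdd : ∃ K : ℝ, ∀ s ∈ Icc (0:ℝ) 1,
      Summable (fun i => ⟪Q s (e i), e i⟫_ℝ) ∧ (∑' i, ⟪Q s (e i), e i⟫_ℝ) ≤ K) :
    ∃ C > (0:ℝ), ∀ t ≥ (0:ℝ),
      Summable (fun i => ⟪Q t (e i), e i⟫_ℝ) ∧
      (∑' i, ⟪Q t (e i), e i⟫_ℝ) ≤ C * Real.exp (2 * lam₀ * t) := by
  obtain ⟨K, hK⟩ := hbdd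
  have hK0 : 0 ≤ K :=
    (tsum_nonneg fun i => hQpos 0 le_rfl (e i)).trans (hK 0 (by simp)).2
  -- one application of the cocycle identity, with increment in `[0, 1]`
  have hstep : ∀ t ≥ (0:ℝ), ∀ s ∈ Icc (0:ℝ) 1, Summable (fun i => ⟪Q t (e i), e i⟫_ℝ) →
      Summable (fun i => ⟪Q (t + s) (e i), e i⟫_ℝ) ∧
      (∑' i, ⟪Q (t + s) (e i), e i⟫_ℝ) ≤
        (∑' i, ⟪Q t (e i), e i⟫_ℝ) + M ^ 2 * K * Real.exp (2 * lam₀ * t) := by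
    intro t ht s hs hsum
    obtain ⟨h1, h2⟩ := summable_and_tsum_inner_conj_le (Q s) (L t) (hQsa s hs.1) (hQpos s hs.1) e
      (hK s hs).1
    have heq : ∀ i, ⟪Q (t + s) (e i), e i⟫_ℝ = ⟪Q t (e i), e i⟫_ℝ +
        ⟪Q s (ContinuousLinearMap.adjoint (L t) (e i)),
          ContinuousLinearMap.adjoint (L t) (e i)⟫_ℝ := fun i => by
      rw [hQcoc s hs.1 t ht, ContinuousLinearMap.adjoint_inner_right]
      simp [inner_add_left]
    simp only [heq]
    refine ⟨hsum.add h1, ?_⟩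
    rw [hsum.tsum_add h1]
    gcongr
    calc _ ≤ ‖L t‖ ^ 2 * ∑' i, ⟪Q s (e i), e i⟫_ℝ := h2
      _ ≤ (M * Real.exp (lam₀ * t)) ^ 2 * K := by
          gcongr
          · exact tsum_nonneg fun i => hQpos s hs.1 (e i)
          · exact hLbound t ht
          · exact (hK s hs).2
      _ = M ^ 2 * K * Real.exp (2 * lam₀ * t) := by
          rw [mul_pow, ← Real.exp_nat_mul]
          push_cast
          ring_nf
  have hd : 0 < Real.exp (2 * lam₀) - 1 := by
    have := Real.add_one_lt_exp (x := 2 * lam₀) (by positivity)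
    linarith
  obtain ⟨A, hA⟩ : ∃ A, A = K + M ^ 2 * K / (Real.exp (2 * lam₀) - 1) := ⟨_, rfl⟩
  have hA0 : 0 ≤ A := by rw [hA]; positivity
  have hAstep : A + M ^ 2 * K ≤ A * Real.exp (2 * lam₀) := by
    have h : M ^ 2 * K / (Real.exp (2 * lam₀) - 1) * (Real.exp (2 * lam₀) - 1) = M ^ 2 * K :=
      div_mul_cancel₀ _ hd.ne'
    have h' : 0 ≤ K * (Real.exp (2 * lam₀) - 1) := by positivity
    have h'' : A * (Real.exp (2 * lam₀) - 1) = K * (Real.exp (2 * lam₀) - 1) + M ^ 2 * K := by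
      rw [hA, add_mul, h]
    linarith
  have hnat : ∀ n : ℕ, Summable (fun i => ⟪Q n (e i), e i⟫_ℝ) ∧
      (∑' i, ⟪Q n (e i), e i⟫_ℝ) ≤ A * Real.exp (2 * lam₀ * n) := by
    intro n
    induction n with
    | zero =>
      obtain ⟨h1, h2⟩ := hK 0 (by simp)
      have h3 : K ≤ A := by
        rw [hA]
        exact le_add_of_nonneg_right (by positivity)
      simpa using And.intro h1 (h2.trans h3)
    | succ n ih =>
      obtain ⟨h1, h2⟩ := hstep n n.cast_nonneg 1 (by simp) ih.1
      push_cast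
      refine ⟨h1, h2.trans ?_⟩
      calc _ ≤ A * Real.exp (2 * lam₀ * n) + M ^ 2 * K * Real.exp (2 * lam₀ * n) := by
            gcongr
            exact ih.2
        _ = (A + M ^ 2 * K) * Real.exp (2 * lam₀ * n) := by ring
        _ ≤ A * Real.exp (2 * lam₀) * Real.exp (2 * lam₀ * n) := by gcongr
        _ = A * Real.exp (2 * lam₀ * (n + 1)) := by
            rw [mul_assoc, ← Real.exp_add]
            ring_nf
  refine ⟨A + M ^ 2 * K + 1, by positivity, fun t ht => ?_⟩
  have hfloor : (⌊t⌋₊ : ℝ) ≤ t := Nat.floor_le ht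
  obtain ⟨h1, h2⟩ := hstep ⌊t⌋₊ (Nat.cast_nonneg _) (t - ⌊t⌋₊)
    ⟨by linarith, by linarith [Nat.lt_floor_add_one t]⟩ (hnat _).1
  rw [add_sub_cancel] at h1 h2
  refine ⟨h1, h2.trans ?_⟩
  calc _ ≤ A * Real.exp (2 * lam₀ * ⌊t⌋₊) + M ^ 2 * K * Real.exp (2 * lam₀ * ⌊t⌋₊) := by
        gcongr
        exact (hnat _).2
    _ = (A + M ^ 2 * K) * Real.exp (2 * lam₀ * ⌊t⌋₊) := by ring
    _ ≤ (A + M ^ 2 * K + 1) * Real.exp (2 * lam₀ * t) := by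
        refine mul_le_mul (by linarith) ?_ (Real.exp_pos _).le (by positivity)
        gcongr
end

section
/- Let H₁, H₂ be real separable Hilbert spaces and let (X,Y) be an H₁×H₂-valued Gaussian random vector with means m_X = E X, m_Y = E Y, covariance operator C_X on H₁ given by ⟨C_X h, h'⟩ = E⟨X−m_X,h⟩⟨X−m_X,h'⟩, and cross-covariance operator C_{YX} : H₂ → H₁ given by ⟨C_{YX} k, h⟩ = E⟨X−m_X,h⟩⟨Y−m_Y,k⟩. Let C_X^{1/2} be the nonnegative selfadjoint square root of C_X. Then the range of C_{YX} is contained in the range of C_X^{1/2}, and the unique bounded operator K : H₂ → H₁ with C_X^{1/2} K = C_{YX} and Range(K) contained in the closure of Range(C_X) is Hilbert–Schmidt, i.e. Σ_i ‖K f_i‖² < ∞ for any orthonormal basis (f_i) of H₂. -/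
open MeasureTheory ProbabilityTheory Set
open scoped InnerProductSpace NNReal

/-- A Borel probability measure on a real normed space is Gaussian if every continuous
linear functional has a (possibly degenerate) Gaussian distribution under it. -/
def IsGaussianLaw {E : Type} [NormedAddCommGroup E] [NormedSpace ℝ E]
    [MeasurableSpace E] (μ : Measure E) : Prop :=
  ∀ ℓ : E →L[ℝ] ℝ, ∃ (a : ℝ) (v : ℝ≥0), μ.map ℓ = gaussianReal a v

/-- A vector `b` with `|⟪b, h⟫| ≤ c ‖S h‖` for all `h` is in the range of the adjoint of `S`,
with a preimage of norm at most `c`. -/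
lemma exists_adjoint_apply_eq_of_abs_inner_le {E : Type*} [NormedAddCommGroup E]
    [InnerProductSpace ℝ E] [CompleteSpace E] (S : E →L[ℝ] E) (b : E) {c : ℝ} (hc : 0 ≤ c)
    (hb : ∀ h, |⟪b, h⟫_ℝ| ≤ c * ‖S h‖) :
    ∃ v, ContinuousLinearMap.adjoint S v = b ∧ ‖v‖ ≤ c := by
  have hwell : ∀ h h', S h = S h' → ⟪b, h⟫_ℝ = ⟪b, h'⟫_ℝ := fun h h' e ↦ by
    have := hb (h - h')
    rw [map_sub, e, sub_self, norm_zero, mul_zero, inner_sub_right] at this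
    exact sub_eq_zero.1 (abs_nonpos_iff.1 this)
  choose g hg using fun y : S.range ↦ y.2
  let φ : S.range →ₗ[ℝ] ℝ :=
    { toFun := fun y ↦ ⟪b, g y⟫_ℝ
      map_add' := fun x y ↦ by
        rw [← inner_add_right]
        exact hwell _ _ (by rw [map_add]; exact (hg _).trans (congrArg₂ _ (hg x) (hg y)).symm)
      map_smul' := fun r x ↦ by
        rw [RingHom.id_apply, smul_eq_mul, ← real_inner_smul_right]
        exact hwell _ _ (by rw [map_smul]; exact (hg _).trans (congrArg _ (hg x)).symm) }
  have hφ : ∀ y, ‖φ y‖ ≤ c * ‖y‖ := fun y ↦ by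
    have := hb (g y)
    rwa [show S (g y) = y from hg y] at this
  obtain ⟨F, hF, hFn⟩ := exists_extension_norm_eq S.range (φ.mkContinuous c hφ)
  refine ⟨(InnerProductSpace.toDual ℝ E).symm F, ext_inner_right ℝ fun h ↦ ?_, ?_⟩
  · rw [ContinuousLinearMap.adjoint_inner_left, InnerProductSpace.toDual_symm_apply,
      hF ⟨S h, h, rfl⟩]
    exact hwell _ _ (hg ⟨S h, h, rfl⟩)
  · rw [LinearIsometryEquiv.norm_map, hFn]
    exact LinearMap.mkContinuous_norm_le _ hc _

/-- The orthogonal complement of the range of the square of a selfadjoint operator is its kernel. -/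
lemma mem_orthogonal_range_comp_self_iff {E : Type*} [NormedAddCommGroup E]
    [InnerProductSpace ℝ E] [CompleteSpace E] {S : E →L[ℝ] E}
    (hS : ContinuousLinearMap.adjoint S = S) (w : E) :
    w ∈ ((S.comp S).range)ᗮ ↔ S w = 0 := by
  have hsymm : ∀ x y, ⟪S x, y⟫_ℝ = ⟪x, S y⟫_ℝ := fun x y ↦ by
    conv_lhs => rw [← hS, ContinuousLinearMap.adjoint_inner_left]
  rw [Submodule.mem_orthogonal']
  constructor
  · intro h
    have := h (S (S w)) ⟨w, rfl⟩
    rw [← hsymm] at this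
    exact inner_self_eq_zero.1 this
  · rintro h _ ⟨z, rfl⟩
    change ⟪w, S (S z)⟫_ℝ = 0
    rw [← hsymm, h, inner_zero_left]

/-- If `|⟪B k, h⟫| ≤ c k * ‖S h‖` with `S` selfadjoint and `c k ≤ M ‖k‖`, then `B` factors
through `S` by a unique bounded operator with values in the closure of the range of `S ∘ S`,
and this operator satisfies `‖K k‖ ≤ c k`. -/
lemma exists_unique_comp_eq_of_abs_inner_le {E F : Type*} [NormedAddCommGroup E]
    [InnerProductSpace ℝ E] [CompleteSpace E] [NormedAddCommGroup F] [NormedSpace ℝ F]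
    {S : E →L[ℝ] E} (hS : ContinuousLinearMap.adjoint S = S) (B : F →L[ℝ] E)
    (c : F → ℝ) (hc : ∀ k, 0 ≤ c k) (M : ℝ) (hM : ∀ k, c k ≤ M * ‖k‖)
    (hB : ∀ k h, |⟪B k, h⟫_ℝ| ≤ c k * ‖S h‖) :
    ∃ K : F →L[ℝ] E, S.comp K = B ∧
      (∀ k, K k ∈ closure (Set.range (S.comp S))) ∧
      (∀ K' : F →L[ℝ] E, S.comp K' = B →
        (∀ k, K' k ∈ closure (Set.range (S.comp S))) → K' = K) ∧
      ∀ k, ‖K k‖ ≤ c k := by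
  set V : Submodule ℝ E := (S.comp S).range.topologicalClosure with hV
  have hVmem : ∀ x, x ∈ closure (Set.range (S.comp S)) ↔ x ∈ V := fun x ↦ by
    rw [hV, ← SetLike.mem_coe, Submodule.topologicalClosure_coe]
    rfl
  have hVorth : ∀ w, w ∈ Vᗮ ↔ S w = 0 := fun w ↦ by
    rw [hV, Submodule.orthogonal_closure, mem_orthogonal_range_comp_self_iff hS]
  have : CompleteSpace V := (Submodule.isClosed_topologicalClosure _).completeSpace_coe
  have hex : ∀ k, ∃ u ∈ V, S u = B k ∧ ‖u‖ ≤ c k := fun k ↦ by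
    obtain ⟨v, hv, hvn⟩ := exists_adjoint_apply_eq_of_abs_inner_le S (B k) (hc k) (hB k)
    rw [hS] at hv
    refine ⟨V.starProjection v, V.starProjection_apply_mem v, ?_,
      (V.norm_starProjection_apply_le v).trans hvn⟩
    have := (hVorth _).1 (V.sub_starProjection_mem_orthogonal v)
    rw [map_sub, sub_eq_zero] at this
    rw [← this, hv]
  have huniq : ∀ u ∈ V, ∀ u' ∈ V, S u = S u' → u = u' := fun u hu u' hu' e ↦ by
    have h : u - u' ∈ Vᗮ := (hVorth _).2 (by rw [map_sub, e, sub_self])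
    exact sub_eq_zero.1 <| inner_self_eq_zero.1 <|
      (Submodule.mem_orthogonal _ _).1 h _ (V.sub_mem hu hu')
  choose u huV hSu hun using hex
  let K : F →L[ℝ] E := LinearMap.mkContinuous
    { toFun := u
      map_add' := fun x y ↦ huniq _ (huV _) _ (V.add_mem (huV _) (huV _)) (by simp [hSu])
      map_smul' := fun r x ↦ huniq _ (huV _) _ (V.smul_mem _ (huV _)) (by simp [hSu]) }
    M (fun k ↦ (hun k).trans (hM k))
  refine ⟨K, ContinuousLinearMap.ext hSu, fun k ↦ (hVmem _).2 (huV k), fun K' hK' hK'V ↦ ?_, hun⟩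
  ext k
  refine huniq _ ((hVmem _).1 (hK'V k)) _ (huV k) ?_
  exact (DFunLike.congr_fun hK' k).trans (hSu k).symm

/-- The Cauchy–Schwarz inequality for square integrable real functions. -/
lemma abs_integral_mul_le_sqrt_mul_sqrt {α : Type*} [MeasurableSpace α] {μ : Measure α}
    {f g : α → ℝ} (hf : MemLp f 2 μ) (hg : MemLp g 2 μ) :
    |∫ x, f x * g x ∂μ| ≤ √(∫ x, g x ^ 2 ∂μ) * √(∫ x, f x ^ 2 ∂μ) := by
  have hfg : Integrable (fun x ↦ f x * g x) μ := hf.integrable_mul hg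
  have hquad : ∀ t : ℝ, 0 ≤ (∫ x, f x ^ 2 ∂μ) * (t * t) + (2 * ∫ x, f x * g x ∂μ) * t
      + ∫ x, g x ^ 2 ∂μ := fun t ↦ by
    have h : ∫ x, (t * f x + g x) ^ 2 ∂μ = (∫ x, f x ^ 2 ∂μ) * (t * t)
        + (2 * ∫ x, f x * g x ∂μ) * t + ∫ x, g x ^ 2 ∂μ := by
      have h₁ : Integrable (fun x ↦ f x ^ 2 * (t * t)) μ := hf.integrable_sq.mul_const _
      have h₂ : Integrable (fun x ↦ 2 * (f x * g x) * t) μ := (hfg.const_mul _).mul_const _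
      have h₁₂ : Integrable (fun x ↦ f x ^ 2 * (t * t) + 2 * (f x * g x) * t) μ := h₁.add h₂
      rw [← integral_mul_const, ← integral_const_mul, ← integral_mul_const,
        ← integral_add h₁ h₂, ← integral_add h₁₂ hg.integrable_sq]
      exact integral_congr_ae (.of_forall fun x ↦ by ring)
    rw [← h]
    exact integral_nonneg fun x ↦ sq_nonneg _
  have hd := discrim_le_zero hquad
  rw [discrim] at hd
  rw [← Real.sqrt_mul (integral_nonneg fun x ↦ sq_nonneg _)]
  exact Real.abs_le_sqrt (by linarith)

/-- The second moments of a square integrable Hilbert space valued function along an orthonormal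
family are summable. -/
lemma Orthonormal.summable_integral_inner_sq {α ι E : Type*} [MeasurableSpace α] {μ : Measure α}
    [NormedAddCommGroup E] [InnerProductSpace ℝ E] {Z : α → E} (hZ : MemLp Z 2 μ)
    {f : ι → E} (hf : Orthonormal ℝ f) : Summable fun i ↦ ∫ x, ⟪Z x, f i⟫_ℝ ^ 2 ∂μ := by
  refine summable_of_sum_le (c := ∫ x, ‖Z x‖ ^ 2 ∂μ)
    (fun i ↦ integral_nonneg fun x ↦ sq_nonneg _) fun s ↦ ?_
  have hint : ∀ i ∈ s, Integrable (fun x ↦ ⟪Z x, f i⟫_ℝ ^ 2) μ :=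
    fun i _ ↦ (hZ.inner_const (f i)).integrable_sq
  rw [← integral_finsetSum s hint]
  refine integral_mono (integrable_finsetSum s hint) hZ.norm.integrable_sq fun x ↦ ?_
  simpa [real_inner_comm] using hf.sum_inner_products_le (Z x) (s := s)

/-- Both components of a Gaussian vector are square integrable. -/
lemma IsGaussianLaw.memLp_two {Ω : Type*} [MeasurableSpace Ω] {P : Measure Ω} {E F : Type}
    [NormedAddCommGroup E] [NormedSpace ℝ E] [CompleteSpace E]
    [SecondCountableTopology E] [MeasurableSpace E] [BorelSpace E]
    [NormedAddCommGroup F] [NormedSpace ℝ F] [CompleteSpace F]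
    [SecondCountableTopology F] [MeasurableSpace F] [BorelSpace F]
    {X : Ω → E} {Y : Ω → F} (hX : Measurable X) (hY : Measurable Y)
    (h : IsGaussianLaw (P.map fun ω ↦ (X ω, Y ω))) : MemLp X 2 P ∧ MemLp Y 2 P := by
  have : IsGaussian (P.map fun ω ↦ (X ω, Y ω)) := isGaussian_of_map_eq_gaussianReal h
  have hXY : MemLp (fun ω ↦ (X ω, Y ω)) 2 P :=
    (memLp_map_measure_iff (by fun_prop) (by fun_prop)).1
      (IsGaussian.memLp_two_id (μ := P.map fun ω ↦ (X ω, Y ω)))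
  exact ⟨hXY.of_le hX.aestronglyMeasurable (.of_forall fun ω ↦ norm_fst_le (X ω, Y ω)),
    hXY.of_le hY.aestronglyMeasurable (.of_forall fun ω ↦ norm_snd_le (X ω, Y ω))⟩

/-- Theorem 3.1(a): for a Gaussian vector `(X,Y)` in `H₁ × H₂`, the range
of the cross-covariance `C_{YX}` is contained in the range of `C_X^{1/2}`, and the unique
bounded `K : H₂ → H₁` with `C_X^{1/2}K = C_{YX}` and range inside `closure(Range C_X)` is
Hilbert–Schmidt. -/
theorem gaussian_cross_covariance_hilbert_schmidt
    {Ω : Type} [MeasurableSpace Ω] (P : Measure Ω) [IsProbabilityMeasure P]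
    {H₁ H₂ : Type}
    [NormedAddCommGroup H₁] [InnerProductSpace ℝ H₁] [CompleteSpace H₁]
    [TopologicalSpace.SeparableSpace H₁] [MeasurableSpace H₁] [BorelSpace H₁]
    [NormedAddCommGroup H₂] [InnerProductSpace ℝ H₂] [CompleteSpace H₂]
    [TopologicalSpace.SeparableSpace H₂] [MeasurableSpace H₂] [BorelSpace H₂]
    (X : Ω → H₁) (Y : Ω → H₂) (hX : Measurable X) (hY : Measurable Y)
    -- (X,Y) is a Gaussian random vector
    (hgauss : IsGaussianLaw (P.map (fun ω => (X ω, Y ω))))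
    -- means
    (mX : H₁) (hmX : mX = ∫ ω, X ω ∂P) (mY : H₂) (hmY : mY = ∫ ω, Y ω ∂P)
    -- covariance of X and cross-covariance of (Y,X)
    (CX : H₁ →L[ℝ] H₁)
    (hCX : ∀ h h' : H₁, ⟪CX h, h'⟫_ℝ = ∫ ω, ⟪X ω - mX, h⟫_ℝ * ⟪X ω - mX, h'⟫_ℝ ∂P)
    (CYX : H₂ →L[ℝ] H₁)
    (hCYX : ∀ (k : H₂) (h : H₁),
      ⟪CYX k, h⟫_ℝ = ∫ ω, ⟪X ω - mX, h⟫_ℝ * ⟪Y ω - mY, k⟫_ℝ ∂P)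
    -- S = C_X^{1/2}: the nonnegative selfadjoint square root of C_X
    (S : H₁ →L[ℝ] H₁)
    (hSsa : ContinuousLinearMap.adjoint S = S)
    (hSpos : ∀ h : H₁, 0 ≤ ⟪S h, h⟫_ℝ)
    (hSsq : S.comp S = CX) :
    -- range inclusion Im C_{YX} ⊆ Im C_X^{1/2}
    (∀ k : H₂, ∃ h : H₁, S h = CYX k) ∧
    -- the unique K with S ∘ K = C_{YX} and Range K ⊆ closure (Range C_X) is Hilbert–Schmidt
    (∃ K : H₂ →L[ℝ] H₁,
      S.comp K = CYX ∧
      (∀ k : H₂, K k ∈ closure (Set.range (⇑CX))) ∧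
      (∀ K' : H₂ →L[ℝ] H₁,
        S.comp K' = CYX → (∀ k : H₂, K' k ∈ closure (Set.range (⇑CX))) → K' = K) ∧
      (∀ (ι : Type) (f : HilbertBasis ι ℝ H₂), Summable (fun i => ‖K (f i)‖ ^ 2))) := by
  have : SecondCountableTopology H₁ := UniformSpace.secondCountable_of_separable H₁
  have : SecondCountableTopology H₂ := UniformSpace.secondCountable_of_separable H₂
  obtain ⟨hX2, hY2⟩ := hgauss.memLp_two hX hY
  have hXc : MemLp (fun ω ↦ X ω - mX) 2 P := hX2.sub (memLp_const mX)
  have hYc : MemLp (fun ω ↦ Y ω - mY) 2 P := hY2.sub (memLp_const mY)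
  have hSnorm : ∀ h, √(∫ ω, ⟪X ω - mX, h⟫_ℝ ^ 2 ∂P) = ‖S h‖ := fun h ↦ by
    simp_rw [pow_two]
    rw [← hCX h h, ← hSsq, ContinuousLinearMap.comp_apply]
    conv_lhs => rw [← hSsa, ContinuousLinearMap.adjoint_inner_left, hSsa,
      real_inner_self_eq_norm_sq, Real.sqrt_sq (norm_nonneg _)]
  have hbound : ∀ k h, |⟪CYX k, h⟫_ℝ| ≤ √(∫ ω, ⟪Y ω - mY, k⟫_ℝ ^ 2 ∂P) * ‖S h‖ :=
    fun k h ↦ by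
      rw [hCYX, ← hSnorm]
      exact abs_integral_mul_le_sqrt_mul_sqrt (hXc.inner_const h) (hYc.inner_const k)
  have hM : ∀ k, √(∫ ω, ⟪Y ω - mY, k⟫_ℝ ^ 2 ∂P) ≤ √(∫ ω, ‖Y ω - mY‖ ^ 2 ∂P) * ‖k‖ :=
    fun k ↦ by
      rw [← Real.sqrt_sq (norm_nonneg k), ← Real.sqrt_mul (integral_nonneg fun ω ↦ sq_nonneg _),
        ← integral_mul_const]
      refine Real.sqrt_le_sqrt (integral_mono (hYc.inner_const k).integrable_sq
        (hYc.norm.integrable_sq.mul_const _) fun ω ↦ ?_)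
      rw [← mul_pow, sq_le_sq, abs_of_nonneg (by positivity : 0 ≤ ‖Y ω - mY‖ * ‖k‖)]
      exact abs_real_inner_le_norm _ _
  obtain ⟨K, hSK, hKmem, hKuniq, hKn⟩ := exists_unique_comp_eq_of_abs_inner_le hSsa CYX _
    (fun k ↦ Real.sqrt_nonneg _) _ hM hbound
  rw [hSsq] at hKmem hKuniq
  refine ⟨fun k ↦ ⟨K k, DFunLike.congr_fun hSK k⟩, K, hSK, hKmem, hKuniq, fun ι f ↦ ?_⟩
  refine (f.orthonormal.summable_integral_inner_sq hYc).of_nonneg_of_le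
    (fun i ↦ sq_nonneg _) fun i ↦ ?_
  rw [← Real.sq_sqrt (integral_nonneg fun ω ↦ sq_nonneg ⟪Y ω - mY, f i⟫_ℝ)]
  gcongr
  exact hKn _
end
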